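/- arXiv:2412.20773 — 4 statements merged into one kernel-verified Lean document; each statement's English description precedes it below -/
import Mathlib

section
/- Let α, β > 0, μ a positive Borel measure on [0,1], and Λ a quasi-lacunary sequence. Let 1 ≤ p < q < ∞, r ∈ (p,q), and θ ∈ (0,1) with 1/r = (1−θ)/p + θ/q. If a sublinear operator T acting on M_Λ is of restricted weak type p and of restricted weak type q with constants C_p(k) and C_q(k), then T is of restricted strong type r with constants C_r(k) ≤ C · C_p(k)^{1−θ} C_q(k)^{θ}, where C depends only on Λ, α, β, p, q, r (and in particular not on k or T). -/
open MeasureTheory Set Filter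

/-- The weighted measure `dν_{α-1} = (1-x)^{α-1} dx` on `[0,1]`. -/
noncomputable def nuMeas (α : ℝ) : MeasureTheory.Measure ℝ :=
  (MeasureTheory.volume.restrict (Set.Icc (0:ℝ) 1)).withDensity
    fun x => ENNReal.ofReal ((1 - x) ^ (α - 1))

/-- The space of Müntz polynomials `t ↦ ∑_{k=0}^K a_k t^{λ_k}`. -/
def MuntzPoly (Λ : ℕ → ℝ) : Set (ℝ → ℂ) :=
  { f | ∃ K : ℕ, ∃ a : ℕ → ℂ,
      f = fun t : ℝ => ∑ k ∈ Finset.range (K + 1), a k * ((t ^ (Λ k) : ℝ) : ℂ) }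

/-- The block space `F_k = Span{t^λ : λ ∈ E_k}`, where the `k`-th block consists of the
indices `j` with `n k ≤ j < n (k+1)`. -/
def BlockSpace (Λ : ℕ → ℝ) (n : ℕ → ℕ) (k : ℕ) : Set (ℝ → ℂ) :=
  { f | ∃ a : ℕ → ℂ,
      f = fun t : ℝ => ∑ j ∈ Finset.Ico (n k) (n (k + 1)), a j * ((t ^ (Λ j) : ℝ) : ℂ) }

/-- `Λ` is a quasi-lacunary sequence: an increasing positive sequence with summable
inverses, partitioned into consecutive blocks of length at most `N` (block `k` being the
indices in `[n k, n (k+1))`), whose block endpoints form an (eventually) lacunary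
sequence. -/
structure IsQuasiLacunary (Λ : ℕ → ℝ) (n : ℕ → ℕ) (N : ℕ) : Prop where
  pos : ∀ k, 0 < Λ k
  mono : StrictMono Λ
  sum_inv : Summable fun k => 1 / Λ k
  one_le_N : 1 ≤ N
  n_zero : n 0 = 0
  n_mono : StrictMono n
  block_le : ∀ k, n (k + 1) - n k ≤ N
  ratio : ∃ q : ℝ, 1 < q ∧ ∀ᶠ k in Filter.atTop, q * Λ (n k) < Λ (n (k + 1))

/-- The block endpoints of `Λ` form a subgeometric sequence. -/
def IsSubgeometric (Λ : ℕ → ℝ) (n : ℕ → ℕ) : Prop :=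
  ∃ q' : ℝ, 1 < q' ∧ ∀ᶠ k in Filter.atTop, Λ (n (k + 1)) ≤ q' * Λ (n k)

/-- `T` is a sublinear operator acting on `M_Λ`, producing `μ`-measurable functions. -/
def SublinearOn (Λ : ℕ → ℝ) (μ : MeasureTheory.Measure ℝ)
    (T : (ℝ → ℂ) → ℝ → ℂ) : Prop :=
  (∀ f ∈ MuntzPoly Λ, AEMeasurable (T f) μ) ∧
  (∀ c : ℂ, ∀ f ∈ MuntzPoly Λ, ∀ t : ℝ, ‖T (fun x => c * f x) t‖ = ‖c‖ * ‖T f t‖) ∧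
  (∀ f ∈ MuntzPoly Λ, ∀ g ∈ MuntzPoly Λ, ∀ t : ℝ,
      ‖T (f + g) t‖ ≤ ‖T f t‖ + ‖T g t‖) ∧
  (∀ f ∈ MuntzPoly Λ, ∀ g ∈ MuntzPoly Λ, ∀ t : ℝ,
      ‖T f t - T g t‖ ≤ ‖T (f - g) t‖)

/-- `T` is of restricted weak type `r` with constants `Cr k`:
`μ(|Tf| > λ) ≤ Cr(k)^r λ^{-r} ‖f‖^r_{L^{r/β}(dν_{α-1})}` for every `f ∈ F_k`, `λ > 0`. -/
def RestrictedWeakType (Λ : ℕ → ℝ) (n : ℕ → ℕ) (α β : ℝ)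
    (μ : MeasureTheory.Measure ℝ) (T : (ℝ → ℂ) → ℝ → ℂ) (r : ℝ) (Cr : ℕ → ℝ) : Prop :=
  ∀ k : ℕ, ∀ f ∈ BlockSpace Λ n k, ∀ lam : ℝ, 0 < lam →
    μ {t : ℝ | lam < ‖T f t‖} ≤
      ENNReal.ofReal (Cr k ^ r * lam⁻¹ ^ r) *
        MeasureTheory.eLpNorm f (ENNReal.ofReal (r / β)) (nuMeas α) ^ r

/-- `T` is of restricted strong type `r` with constants `Cr k`:
`‖Tf‖_{L^r(dμ)} ≤ Cr(k) ‖f‖_{L^{r/β}(dν_{α-1})}` for every `f ∈ F_k`. -/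
def RestrictedStrongType (Λ : ℕ → ℝ) (n : ℕ → ℕ) (α β : ℝ)
    (μ : MeasureTheory.Measure ℝ) (T : (ℝ → ℂ) → ℝ → ℂ) (r : ℝ) (Cr : ℕ → ℝ) : Prop :=
  ∀ k : ℕ, ∀ f ∈ BlockSpace Λ n k,
    MeasureTheory.eLpNorm (T f) (ENNReal.ofReal r) μ ≤
      ENNReal.ofReal (Cr k) *
        MeasureTheory.eLpNorm f (ENNReal.ofReal (r / β)) (nuMeas α)

/-- The condition `B_{p,Λ}(α,β)`: `sup_k λ_{n_k}^{αβ} ∫ t^{p λ_{n_k}} dμ < ∞`. -/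
def CondB (Λ : ℕ → ℝ) (n : ℕ → ℕ) (α β p : ℝ) (μ : MeasureTheory.Measure ℝ) : Prop :=
  ∃ B : ℝ, ∀ k : ℕ,
    ENNReal.ofReal (Λ (n k) ^ (α * β)) *
        ∫⁻ t in Set.Icc (0:ℝ) 1, ENNReal.ofReal (t ^ (p * Λ (n k))) ∂μ ≤
      ENNReal.ofReal B

/-- The condition `A_{p,Λ}(α,β)`:
`∑_k λ_{n_k}^{αβ/(1-β)} (∫ t^{p λ_{n_k}} dμ)^{1/(1-β)} < ∞`. -/
def CondA (Λ : ℕ → ℝ) (n : ℕ → ℕ) (α β p : ℝ) (μ : MeasureTheory.Measure ℝ) : Prop :=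
  (∑' k : ℕ, ENNReal.ofReal (Λ (n k) ^ (α * β / (1 - β))) *
      (∫⁻ t in Set.Icc (0:ℝ) 1, ENNReal.ofReal (t ^ (p * Λ (n k))) ∂μ) ^ (1 / (1 - β))) < ⊤

/-- The image under `T` of the unit ball of `M_Λ` (with the `L^{r/β}(dν_{α-1})` norm)
is totally bounded in `L^r(dμ)`. -/
def CompactEmbed (Λ : ℕ → ℝ) (α β r : ℝ) (μ : MeasureTheory.Measure ℝ)
    (T : (ℝ → ℂ) → ℝ → ℂ) : Prop :=
  ∀ δ : ℝ, 0 < δ → ∃ G : Set (ℝ → ℂ), G.Finite ∧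
    ∀ f ∈ MuntzPoly Λ,
      MeasureTheory.eLpNorm f (ENNReal.ofReal (r / β)) (nuMeas α) ≤ 1 →
      ∃ g ∈ G, MeasureTheory.eLpNorm (fun t => T f t - g t) (ENNReal.ofReal r) μ <
        ENNReal.ofReal δ


lemma weak_interp (p q r θ : ℝ) (hp : 1 ≤ p) (hpq : p < q) (hpr : p < r) (hrq : r < q)
    (hθ0 : 0 < θ) (hθ1 : θ < 1) (hθr : 1 / r = (1 - θ) / p + θ / q)
    (μ : Measure ℝ) (h : ℝ → ℂ) (hm : AEMeasurable h μ) (A B : ℝ) (hA0 : 0 ≤ A) (hB0 : 0 ≤ B)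
    (hA : ∀ l : ℝ, 0 < l → μ {t | l < ‖h t‖} ≤ ENNReal.ofReal (A ^ p * l⁻¹ ^ p))
    (hB : ∀ l : ℝ, 0 < l → μ {t | l < ‖h t‖} ≤ ENNReal.ofReal (B ^ q * l⁻¹ ^ q)) :
    eLpNorm h (ENNReal.ofReal r) μ ≤
      ENNReal.ofReal ((r / (r - p) + r / (q - r)) ^ (1 / r) * A ^ (1 - θ) * B ^ θ) := by
  have hp0 : 0 < p := by linarith
  have hq0 : 0 < q := by linarith
  have hr0 : 0 < r := by linarith
  have key : ∫⁻ t, ENNReal.ofReal (‖h t‖ ^ r) ∂μ ≤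
      ENNReal.ofReal ((r / (r - p) + r / (q - r)) * (A ^ (1 - θ) * B ^ θ) ^ r) := by
    rw [lintegral_rpow_eq_lintegral_meas_lt_mul μ (Eventually.of_forall fun _ => norm_nonneg _)
      hm.norm hr0]
    by_cases hAB : A = 0 ∨ B = 0
    · have : ∀ l ∈ Ioi (0:ℝ), μ {t | l < ‖h t‖} * ENNReal.ofReal (l ^ (r - 1)) = 0 := by
        intro l hl
        have : μ {t | l < ‖h t‖} = 0 := by
          rcases hAB with h0 | h0
          · have := hA l hl
            rw [h0, Real.zero_rpow hp0.ne'] at this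
            simpa using this
          · have := hB l hl
            rw [h0, Real.zero_rpow hq0.ne'] at this
            simpa using this
        rw [this, zero_mul]
      rw [setLIntegral_congr_fun measurableSet_Ioi this]
      simp
    push Not at hAB
    have hA1 : 0 < A := lt_of_le_of_ne hA0 hAB.1.symm
    have hB1 : 0 < B := lt_of_le_of_ne hB0 hAB.2.symm
    set M : ℝ := (B ^ q / A ^ p) ^ (1 / (q - p)) with hM
    have hM0 : 0 < M := by positivity
    have e1 : ∫⁻ l in Ioc 0 M, μ {t | l < ‖h t‖} * ENNReal.ofReal (l ^ (r - 1)) ≤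
        ENNReal.ofReal (A ^ p * (M ^ (r - p) / (r - p))) := by
      calc _ ≤ ∫⁻ l in Ioc 0 M, ENNReal.ofReal (A ^ p * l ^ (r - p - 1)) := by
            apply setLIntegral_mono' measurableSet_Ioc
            intro l hl
            have hl0 : 0 < l := hl.1
            calc _ ≤ ENNReal.ofReal (A ^ p * l⁻¹ ^ p) * ENNReal.ofReal (l ^ (r - 1)) := by
                  gcongr; exact hA l hl0
              _ = _ := by
                  rw [← ENNReal.ofReal_mul (by positivity)]
                  congr 1
                  rw [Real.inv_rpow hl0.le, ← Real.rpow_neg hl0.le, mul_assoc, ← Real.rpow_add hl0]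
                  ring_nf
        _ = _ := by
            have hi : IntervalIntegrable (fun l : ℝ => l ^ (r - p - 1)) volume 0 M :=
              intervalIntegral.intervalIntegrable_rpow' (by linarith)
            rw [← ofReal_integral_eq_lintegral_ofReal]
            · rw [integral_const_mul, ← intervalIntegral.integral_of_le hM0.le,
                integral_rpow (Or.inl (by linarith))]
              rw [Real.zero_rpow (by linarith)]
              congr 3 <;> ring_nf
            · exact ((intervalIntegrable_iff_integrableOn_Ioc_of_le hM0.le).1 hi).const_mul _
            · filter_upwards [ae_restrict_mem measurableSet_Ioc] with l hl
              have := hl.1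
              simp only [Pi.zero_apply]
              positivity
    have e2 : ∫⁻ l in Ioi M, μ {t | l < ‖h t‖} * ENNReal.ofReal (l ^ (r - 1)) ≤
        ENNReal.ofReal (B ^ q * (M ^ (r - q) / (q - r))) := by
      calc _ ≤ ∫⁻ l in Ioi M, ENNReal.ofReal (B ^ q * l ^ (r - q - 1)) := by
            apply setLIntegral_mono' measurableSet_Ioi
            intro l hl
            have hl0 : 0 < l := hM0.trans hl
            calc _ ≤ ENNReal.ofReal (B ^ q * l⁻¹ ^ q) * ENNReal.ofReal (l ^ (r - 1)) := by
                  gcongr; exact hB l hl0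
              _ = _ := by
                  rw [← ENNReal.ofReal_mul (by positivity)]
                  congr 1
                  rw [Real.inv_rpow hl0.le, ← Real.rpow_neg hl0.le, mul_assoc, ← Real.rpow_add hl0]
                  ring_nf
        _ = _ := by
            rw [← ofReal_integral_eq_lintegral_ofReal]
            · rw [integral_const_mul, integral_Ioi_rpow_of_lt (by linarith) hM0]
              congr 2
              rw [show r - q - 1 + 1 = -(q - r) by ring, neg_div_neg_eq, show -(q-r) = r - q by ring]
            · exact (integrableOn_Ioi_rpow_of_lt (by linarith) hM0).const_mul _
            · filter_upwards [ae_restrict_mem measurableSet_Ioi] with l hl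
              have : 0 < l := hM0.trans hl
              simp only [Pi.zero_apply]
              positivity
    have hθ : θ * (r * (q - p)) = q * (r - p) := by
      field_simp at hθr
      linear_combination hθr
    have hMM : A ^ p * M ^ (r - p) = (A ^ (1 - θ) * B ^ θ) ^ r ∧
        B ^ q * M ^ (r - q) = (A ^ (1 - θ) * B ^ θ) ^ r := by
      have hqp : q - p ≠ 0 := by linarith
      have hth : θ = q * (r - p) / (r * (q - p)) := by
        field_simp
        linear_combination hθ
      have hlM : Real.log M = (q * Real.log B - p * Real.log A) / (q - p) := by
        rw [hM, Real.log_rpow (by positivity), Real.log_div (by positivity) (by positivity),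
          Real.log_rpow hB1, Real.log_rpow hA1]
        ring
      clear_value M
      constructor
      all_goals
        apply Real.log_injOn_pos (by simp only [mem_Ioi]; positivity)
          (by simp only [mem_Ioi]; positivity)
        rw [Real.log_mul (by positivity) (by positivity), Real.log_rpow (by positivity),
          Real.log_rpow (by positivity), Real.log_rpow (by positivity),
          Real.log_mul (by positivity) (by positivity), Real.log_rpow (by positivity),
          Real.log_rpow (by positivity), hlM, hth]
        field_simp
        ring
    rw [← Ioc_union_Ioi_eq_Ioi hM0.le, lintegral_union measurableSet_Ioi
      (Set.disjoint_left.2 fun x hx hx' => not_lt.2 hx.2 hx')]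
    have h1 : 0 < r - p := by linarith
    have h2 : 0 < q - r := by linarith
    calc _ ≤ ENNReal.ofReal r * (ENNReal.ofReal (A ^ p * (M ^ (r - p) / (r - p))) +
          ENNReal.ofReal (B ^ q * (M ^ (r - q) / (q - r)))) := by gcongr
      _ = _ := by
        rw [← ENNReal.ofReal_add (by positivity) (by positivity), ← ENNReal.ofReal_mul hr0.le]
        congr 1
        rw [← mul_div_assoc, ← mul_div_assoc, hMM.1, hMM.2]
        ring
  have h1 : 0 < r - p := by linarith
  have h2 : 0 < q - r := by linarith
  rw [eLpNorm_eq_lintegral_rpow_enorm_toReal (by simpa using hr0) (by simp),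
    ENNReal.toReal_ofReal hr0.le]
  have : ∀ t, ‖h t‖ₑ ^ r = ENNReal.ofReal (‖h t‖ ^ r) := fun t => by
    rw [← ofReal_norm, ENNReal.ofReal_rpow_of_nonneg (norm_nonneg _) hr0.le]
  simp_rw [this]
  calc _ ≤ (ENNReal.ofReal ((r / (r - p) + r / (q - r)) * (A ^ (1 - θ) * B ^ θ) ^ r)) ^ (1 / r) := by
        gcongr
    _ = _ := by
      rw [ENNReal.ofReal_rpow_of_nonneg (by positivity) (by positivity),
        Real.mul_rpow (by positivity) (by positivity), ← Real.rpow_mul (by positivity),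
        mul_one_div_cancel hr0.ne', Real.rpow_one, mul_assoc]

lemma exists_G (Λ : ℕ → ℝ) (pos : ∀ k, 0 < Λ k) (mono : StrictMono Λ) (j0 : ℕ) (J : Finset ℕ) :
    (∀ j ∈ J, j0 < j) → ∃ d : ℕ → ℝ, ∀ x : ℝ, 0 ≤ x →
      |Real.exp (-(Λ j0 * x)) + ∑ j ∈ J, d j * Real.exp (-(Λ j * x))| ≤
        2 ^ J.card * (∏ j ∈ J, (Λ j - Λ j0) / Λ j) * Real.exp (-(Λ j0 / 2 * x)) := by
  induction J using Finset.induction_on with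
  | empty =>
    intro _
    refine ⟨0, fun x hx => ?_⟩
    simp only [Finset.sum_empty, add_zero, Real.abs_exp, Finset.card_empty, pow_zero,
      Finset.prod_empty, one_mul]
    gcongr
    linarith [pos j0]
  | insert i J hi ih =>
    intro hJ
    obtain ⟨d, hd⟩ := ih fun j hj => hJ j (Finset.mem_insert_of_mem hj)
    have hij0 : Λ j0 < Λ i := mono (hJ i (Finset.mem_insert_self _ _))
    have hne : ∀ j ∈ J, Λ i - Λ j ≠ 0 := fun j hj h => by
      have : i = j := mono.injective (by linarith)
      exact hi (this ▸ hj)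
    set a := Λ i with ha
    set ν := Λ j0 with hν
    have hν0 : 0 < ν := pos j0
    set e : ℕ → ℝ := fun j => d j * ((a - ν) / (a - Λ j)) with he
    refine ⟨fun j => if j = i then -(1 + ∑ j ∈ J, e j) else e j, ?_⟩
    set K : ℝ := 2 ^ J.card * (∏ j ∈ J, (Λ j - ν) / Λ j) with hK
    have hK0 : 0 ≤ K := by
      apply mul_nonneg (by positivity)
      apply Finset.prod_nonneg
      intro j hj
      have := mono (hJ j (Finset.mem_insert_of_mem hj))
      apply div_nonneg (by linarith) (pos j).le
    -- the function after multiplication with the exponential weight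
    set U : ℝ → ℝ := fun x => Real.exp ((a - ν) * x) + ∑ j ∈ J, e j * Real.exp ((a - Λ j) * x)
        - (1 + ∑ j ∈ J, e j) with hU
    set H : ℝ → ℝ := fun x => Real.exp (-(ν * x)) + ∑ j ∈ J, d j * Real.exp (-(Λ j * x)) with hH
    have hU' : ∀ x, HasDerivAt U ((a - ν) * Real.exp (a * x) * H x) x := by
      intro x
      have h1 : ∀ c : ℝ, HasDerivAt (fun x : ℝ => Real.exp (c * x)) (Real.exp (c * x) * c) x := by
        intro c
        have := ((hasDerivAt_id x).const_mul c).exp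
        simpa using this
      have h2 := (((h1 (a - ν)).add (HasDerivAt.fun_sum fun j (_ : j ∈ J) =>
        (h1 (a - Λ j)).const_mul (e j))).sub_const (1 + ∑ j ∈ J, e j))
      refine h2.congr_deriv ?_
      simp only [hH]
      rw [mul_add, Finset.mul_sum]
      congr 1
      · rw [mul_assoc, ← Real.exp_add, mul_comm]; ring_nf
      · apply Finset.sum_congr rfl
        intro j hj
        have := hne j hj
        rw [show (a - Λ j) * x = a * x + -(Λ j * x) by ring, Real.exp_add]
        simp only [he]
        field_simp
    have hbound : ∀ x, 0 ≤ x → ‖U x‖ ≤ K * (a - ν) / (a - ν / 2) * Real.exp ((a - ν / 2) * x) := by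
      intro x hx
      have hden : 0 < a - ν / 2 := by linarith
      have := image_norm_le_of_norm_deriv_right_le_deriv_boundary (f := U) (a := 0) (b := x)
        (f' := fun x => (a - ν) * Real.exp (a * x) * H x)
        (B := fun x => K * (a - ν) / (a - ν / 2) * Real.exp ((a - ν / 2) * x))
        (B' := fun x => K * (a - ν) * Real.exp ((a - ν / 2) * x))
        (fun y _ => (hU' y).continuousAt.continuousWithinAt)
        (fun y _ => (hU' y).hasDerivWithinAt)
        (by
          have : U 0 = 0 := by simp [hU]
          rw [this, norm_zero]
          have : 0 ≤ a - ν := by linarith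
          positivity)
        (fun y => by
          have h1 := ((((hasDerivAt_id y).const_mul (a - ν / 2)).exp).const_mul
            (K * (a - ν) / (a - ν / 2)))
          refine (h1.congr_deriv ?_)
          simp only [id, mul_one]
          rw [mul_comm (Real.exp _), ← mul_assoc, div_mul_cancel₀ _ hden.ne'])
        (fun y hy => by
          have h3 := hd y hy.1
          rw [norm_mul, norm_mul, Real.norm_eq_abs, Real.norm_eq_abs, Real.norm_eq_abs,
            Real.abs_exp, abs_of_nonneg (by linarith : 0 ≤ a - ν)]
          calc (a - ν) * Real.exp (a * y) * |H y| ≤ (a - ν) * Real.exp (a * y) *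
                (K * Real.exp (-(ν / 2 * y))) := by
                have : 0 ≤ a - ν := by linarith
                gcongr
            _ = _ := by
                rw [show (a - ν / 2) * y = a * y + -(ν / 2 * y) by ring, Real.exp_add]
                ring)
      exact this ⟨hx, le_rfl⟩
    intro x hx
    have hsum : Real.exp (-(ν * x)) + ∑ j ∈ insert i J,
        (if j = i then -(1 + ∑ j ∈ J, e j) else e j) * Real.exp (-(Λ j * x)) =
        Real.exp (-(a * x)) * U x := by
      rw [Finset.sum_insert hi, if_pos rfl]
      have : ∑ j ∈ J, (if j = i then -(1 + ∑ j ∈ J, e j) else e j) * Real.exp (-(Λ j * x)) =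
          ∑ j ∈ J, Real.exp (-(a * x)) * (e j * Real.exp ((a - Λ j) * x)) := by
        apply Finset.sum_congr rfl
        intro j hj
        rw [if_neg (fun h : j = i => hi (h ▸ hj)), show -(Λ j * x) = -(a * x) + (a - Λ j) * x by ring,
          Real.exp_add]
        ring
      rw [this, ← Finset.mul_sum, show -(ν * x) = -(a * x) + (a - ν) * x by ring, Real.exp_add]
      simp only [hU]
      ring
    rw [hsum, abs_mul, Real.abs_exp, Finset.card_insert_of_notMem hi, Finset.prod_insert hi]
    have hb := hbound x hx
    rw [Real.norm_eq_abs] at hb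
    have hden : 0 < a - ν / 2 := by linarith
    calc Real.exp (-(a * x)) * |U x| ≤ Real.exp (-(a * x)) *
          (K * (a - ν) / (a - ν / 2) * Real.exp ((a - ν / 2) * x)) := by gcongr
      _ = K * (a - ν) / (a - ν / 2) * Real.exp (-(ν / 2 * x)) := by
          rw [show -(ν / 2 * x) = -(a * x) + (a - ν / 2) * x by ring, Real.exp_add]; ring
      _ ≤ K * (a - ν) / (a / 2) * Real.exp (-(ν / 2 * x)) := by
          have : 0 ≤ a - ν := by linarith
          have : 0 < a := pos i
          gcongr
          linarith
      _ = _ := by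
          have : 0 < a := pos i
          rw [hK, pow_succ, ← ha]
          generalize (∏ j ∈ J, (Λ j - ν) / Λ j) = X
          field_simp

lemma finite_diff (z lam : ℕ → ℝ) (s : ℝ) (hs : 0 < s) (hz : ∀ j, z j = s ^ lam j)
    (hz1 : ∀ j, z j ≤ 1) (J I : Finset ℕ) :
    ∀ (a : ℕ → ℂ) (t M : ℝ), 0 < t →
      (∀ k ≤ I.card, ‖∑ j ∈ J, a j * (((t * s ^ k) ^ lam j : ℝ) : ℂ)‖ ≤ M) →
      ‖∑ j ∈ J, a j * ((∏ i ∈ I, (z j - z i) : ℝ) : ℂ) * ((t ^ lam j : ℝ) : ℂ)‖ ≤ 2 ^ I.card * M := by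
  induction I using Finset.induction_on with
  | empty =>
    intro a t M ht h
    simpa using h 0 le_rfl
  | insert i I hi ih =>
    intro a t M ht h
    have := ih (fun j => a j * ((z j - z i : ℝ) : ℂ)) t (2 * M) ht ?_
    · rw [Finset.card_insert_of_notMem hi, pow_succ, mul_assoc]
      refine le_trans (le_of_eq ?_) this
      congr 1
      apply Finset.sum_congr rfl
      intro j _
      rw [Finset.prod_insert hi]
      push_cast
      ring
    · intro k hk
      rw [Finset.card_insert_of_notMem hi] at h
      have h1 := h k (by omega)
      have h2 := h (k + 1) (by omega)
      have e : ∑ j ∈ J, a j * ((z j - z i : ℝ) : ℂ) * (((t * s ^ k) ^ lam j : ℝ) : ℂ) =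
          ∑ j ∈ J, a j * (((t * s ^ (k + 1)) ^ lam j : ℝ) : ℂ) -
          (z i : ℂ) * ∑ j ∈ J, a j * (((t * s ^ k) ^ lam j : ℝ) : ℂ) := by
        rw [Finset.mul_sum, ← Finset.sum_sub_distrib]
        apply Finset.sum_congr rfl
        intro j _
        rw [pow_succ, ← mul_assoc, Real.mul_rpow (x := t * s ^ k) (by positivity) hs.le, ← hz]
        push_cast
        ring
      rw [e]
      have hzi : ‖(z i : ℂ)‖ ≤ 1 := by
        rw [Complex.norm_real, Real.norm_eq_abs, abs_of_nonneg]
        · exact hz1 i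
        · rw [hz]; positivity
      calc _ ≤ ‖∑ j ∈ J, a j * (((t * s ^ (k + 1)) ^ lam j : ℝ) : ℂ)‖ +
          ‖(z i : ℂ)‖ * ‖∑ j ∈ J, a j * (((t * s ^ k) ^ lam j : ℝ) : ℂ)‖ := by
            rw [← norm_mul]; exact norm_sub_le _ _
        _ ≤ M + 1 * M := by gcongr
        _ = _ := by ring

/-- The Müntz polynomial with coefficients `a` supported on the finite index set `J`. -/
noncomputable def mpoly (Λ : ℕ → ℝ) (a : ℕ → ℂ) (J : Finset ℕ) : ℝ → ℂ :=
  fun t => ∑ j ∈ J, a j * ((t ^ (Λ j) : ℝ) : ℂ)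

lemma mpoly_cont (Λ : ℕ → ℝ) (pos : ∀ k, 0 < Λ k) (a : ℕ → ℂ) (J : Finset ℕ) :
    Continuous (mpoly Λ a J) := by
  unfold mpoly
  refine continuous_finsetSum _ fun j _ => continuous_const.mul (Complex.continuous_ofReal.comp ?_)
  exact Real.continuous_rpow_const (pos j).le

lemma nu_dens_meas (α : ℝ) : Measurable fun x : ℝ => ENNReal.ofReal ((1 - x) ^ (α - 1)) := by
  fun_prop

lemma nu_lintegral (α : ℝ) (g : ℝ → ENNReal) (hg : Measurable g) :
    ∫⁻ x, g x ∂(nuMeas α) =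
      ∫⁻ x in Icc (0:ℝ) 1, ENNReal.ofReal ((1 - x) ^ (α - 1)) * g x := by
  unfold nuMeas
  rw [lintegral_withDensity_eq_lintegral_mul _ (nu_dens_meas α) hg]
  rfl

lemma nu_upper (α S ν K : ℝ) (hα : 0 < α) (hS : 0 < S) (hν : 0 < ν) (hK : 0 ≤ K) (g : ℝ → ℂ)
    (hg : ∀ t ∈ Icc (0:ℝ) 1, ‖g t‖ ≤ K * t ^ (ν / 2)) :
    eLpNorm g (ENNReal.ofReal S) (nuMeas α) ≤
      ENNReal.ofReal (K * ((2 / S) ^ α * Real.Gamma α) ^ (1 / S) * ν ^ (-(α / S))) := by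
  have hΓ : 0 < Real.Gamma α := Real.Gamma_pos_of_pos hα
  have h1 : eLpNorm g (ENNReal.ofReal S) (nuMeas α) ≤
      eLpNorm (fun t : ℝ => K * t ^ (ν / 2)) (ENNReal.ofReal S) (nuMeas α) := by
    apply eLpNorm_mono_ae_real
    have : ∀ᵐ x ∂(volume.restrict (Icc (0:ℝ) 1)), ‖g x‖ ≤ K * x ^ (ν / 2) := by
      filter_upwards [ae_restrict_mem measurableSet_Icc] with x hx using hg x hx
    exact (withDensity_absolutelyContinuous _ _).ae_le this
  refine h1.trans ?_
  rw [eLpNorm_eq_lintegral_rpow_enorm_toReal (by simpa using hS) (by simp),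
    ENNReal.toReal_ofReal hS.le, nu_lintegral _ _ (by fun_prop)]
  set u : ℝ := ν * S / 2 with hu
  have hu0 : 0 < u := by positivity
  set F : ℝ → ENNReal := fun y => ENNReal.ofReal (K ^ S * (y ^ (α - 1) * Real.exp (-(u * y))))
    with hF
  have h2 : ∫⁻ x in Icc (0:ℝ) 1, ENNReal.ofReal ((1 - x) ^ (α - 1)) * ‖K * x ^ (ν / 2)‖ₑ ^ S ≤
      ENNReal.ofReal (K ^ S * ((1 / u) ^ α * Real.Gamma α)) := by
    calc _ = ∫⁻ x in Ico (0:ℝ) 1, ENNReal.ofReal ((1 - x) ^ (α - 1)) * ‖K * x ^ (ν / 2)‖ₑ ^ S :=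
          setLIntegral_congr Ico_ae_eq_Icc.symm
      _ ≤ ∫⁻ x in Ico (0:ℝ) 1, (Ioi (0:ℝ)).indicator F (1 - x) := by
          apply setLIntegral_mono' measurableSet_Ico
          intro x hx
          have hx0 : 0 ≤ x := hx.1
          have hx1 : 0 < 1 - x := by linarith [hx.2]
          rw [indicator_of_mem (by exact hx1), ← ofReal_norm,
            ENNReal.ofReal_rpow_of_nonneg (norm_nonneg _) hS.le,
            ← ENNReal.ofReal_mul (by positivity)]
          apply ENNReal.ofReal_le_ofReal
          rw [Real.norm_of_nonneg (by positivity), Real.mul_rpow hK (by positivity),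
            ← Real.rpow_mul hx0, mul_left_comm]
          gcongr
          calc x ^ (ν / 2 * S) ≤ (Real.exp (-(1 - x))) ^ (ν / 2 * S) := by
                gcongr
                linarith [Real.add_one_le_exp (-(1 - x))]
            _ = _ := by
                rw [← Real.exp_mul]
                congr 1
                rw [hu]; ring
      _ ≤ ∫⁻ x, (Ioi (0:ℝ)).indicator F (1 - x) := setLIntegral_le_lintegral _ _
      _ = ∫⁻ y, (Ioi (0:ℝ)).indicator F y := lintegral_sub_left_eq_self _ 1
      _ = ∫⁻ y in Ioi (0:ℝ), F y := lintegral_indicator measurableSet_Ioi _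
      _ = _ := by
          have hi := Real.integral_rpow_mul_exp_neg_mul_Ioi hα hu0
          have hinteg : IntegrableOn (fun x ↦ x ^ (α - 1) * Real.exp (-(u * x))) (Ioi 0) :=
            .of_integral_ne_zero (by rw [hi]; positivity)
          rw [← hi, ← integral_const_mul, ofReal_integral_eq_lintegral_ofReal (hinteg.const_mul _)]
          filter_upwards [ae_restrict_mem measurableSet_Ioi] with y hy
          have : 0 < y := hy
          simp only [Pi.zero_apply]
          positivity
  calc _ ≤ (ENNReal.ofReal (K ^ S * ((1 / u) ^ α * Real.Gamma α))) ^ (1 / S) := by gcongr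
    _ = _ := by
      rw [ENNReal.ofReal_rpow_of_nonneg (by positivity) (by positivity)]
      congr 1
      have : (1 / u) ^ α = (2 / S) ^ α * ν ^ (-α) := by
        rw [hu, Real.rpow_neg hν.le, ← Real.inv_rpow hν.le,
          ← Real.mul_rpow (by positivity) (by positivity)]
        congr 1
        field_simp
      rw [this, show (2 / S) ^ α * ν ^ (-α) * Real.Gamma α =
        ((2 / S) ^ α * Real.Gamma α) * ν ^ (-α) by ring,
        Real.mul_rpow (by positivity) (by positivity),
        Real.mul_rpow (x := (2 / S) ^ α * Real.Gamma α) (by positivity) (by positivity),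
        ← Real.rpow_mul hK, ← Real.rpow_mul hν.le, mul_one_div_cancel hS.ne', Real.rpow_one,
        mul_assoc]
      congr 3
      ring

lemma lower_pointwise (Λ : ℕ → ℝ) (pos : ∀ k, 0 < Λ k) (mono : StrictMono Λ) (N : ℕ)
    (J : Finset ℕ) (j0 : ℕ) (hj0 : j0 ∈ J) (hmin : ∀ j ∈ J, j0 ≤ j) (hcard : J.card ≤ N + 1)
    (a : ℕ → ℂ) (s : ℝ) (hs : s = Real.exp (-(1 / Λ j0))) (t M : ℝ) (ht : s ^ 2 ≤ t)
    (hM : ∀ k ≤ N, ‖mpoly Λ a J (t * s ^ k)‖ ≤ M) :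
    ‖a j0‖ * ∏ j ∈ J.erase j0, (Λ j - Λ j0) / Λ j ≤ Real.exp (N + 2) * 2 ^ N * M := by
  set ν := Λ j0 with hν
  have hν0 : 0 < ν := pos j0
  have hs0 : 0 < s := by rw [hs]; positivity
  have ht0 : 0 < t := lt_of_lt_of_le (by positivity) ht
  have hs1 : s ≤ 1 := by rw [hs, Real.exp_le_one_iff]; simp [hν0.le]
  have hM0 : 0 ≤ M := (norm_nonneg _).trans (hM 0 (Nat.zero_le _))
  have hcI : (J.erase j0).card ≤ N := by rw [Finset.card_erase_of_mem hj0]; omega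
  have hfd := finite_diff (fun j => s ^ Λ j) Λ s hs0 (fun _ => rfl)
    (fun j => Real.rpow_le_one hs0.le hs1 (pos j).le) J (J.erase j0) a t M ht0
    (fun k hk => hM k (hk.trans hcI))
  have hsum : ∑ j ∈ J, a j * ((∏ i ∈ J.erase j0, (s ^ Λ j - s ^ Λ i) : ℝ) : ℂ) *
      ((t ^ Λ j : ℝ) : ℂ) =
      a j0 * ((∏ i ∈ J.erase j0, (s ^ ν - s ^ Λ i) : ℝ) : ℂ) * ((t ^ ν : ℝ) : ℂ) := by
    apply Finset.sum_eq_single_of_mem j0 hj0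
    intro j hj hne
    have : ∏ i ∈ J.erase j0, (s ^ Λ j - s ^ Λ i) = 0 :=
      Finset.prod_eq_zero (Finset.mem_erase.2 ⟨hne, hj⟩) (sub_self _)
    rw [this]
    simp
  rw [hsum, norm_mul, norm_mul, Complex.norm_real, Complex.norm_real] at hfd
  have hsν : s ^ ν = Real.exp (-1) := by
    rw [hs, ← Real.exp_mul]; congr 1; field_simp
  have htν : Real.exp (-2) ≤ t ^ ν := by
    calc Real.exp (-2) = (s ^ 2) ^ ν := by
          rw [← Real.rpow_natCast, ← Real.rpow_mul hs0.le, mul_comm, Real.rpow_mul hs0.le, hsν,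
            ← Real.exp_mul]
          norm_num
      _ ≤ _ := by gcongr
  have hfac : ∀ i ∈ J.erase j0, Real.exp (-1) * ((Λ i - ν) / Λ i) ≤ s ^ ν - s ^ Λ i ∧
      0 ≤ (Λ i - ν) / Λ i := by
    intro i hi
    have hlt : ν < Λ i := mono (lt_of_le_of_ne (hmin i (Finset.mem_of_mem_erase hi))
      (Finset.ne_of_mem_erase hi).symm)
    have hi0 := pos i
    refine ⟨?_, div_nonneg (by linarith) hi0.le⟩
    have : s ^ Λ i = Real.exp (-1) * Real.exp (-((Λ i - ν) / ν)) := by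
      rw [hs, ← Real.exp_mul, ← Real.exp_add]; congr 1; field_simp; ring
    rw [hsν, this]
    have h1 : Real.exp (-((Λ i - ν) / ν)) ≤ ν / Λ i := by
      rw [Real.exp_neg, inv_le_comm₀ (by positivity) (by positivity)]
      calc (ν / Λ i)⁻¹ = (Λ i - ν) / ν + 1 := by field_simp; ring
        _ ≤ _ := Real.add_one_le_exp _
    have h2 : (Λ i - ν) / Λ i = 1 - ν / Λ i := by field_simp
    rw [h2]
    have := Real.exp_pos (-1)
    nlinarith
  have hW : 0 ≤ ∏ j ∈ J.erase j0, (Λ j - ν) / Λ j := Finset.prod_nonneg fun i hi => (hfac i hi).2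
  have hprod : Real.exp (-N) * ∏ j ∈ J.erase j0, (Λ j - ν) / Λ j ≤
      ∏ i ∈ J.erase j0, (s ^ ν - s ^ Λ i) := by
    calc _ ≤ Real.exp (-1) ^ (J.erase j0).card * ∏ j ∈ J.erase j0, (Λ j - ν) / Λ j := by
          gcongr
          rw [← Real.exp_nat_mul]
          gcongr
          have : ((J.erase j0).card : ℝ) ≤ N := by exact_mod_cast hcI
          linarith
      _ = ∏ j ∈ J.erase j0, Real.exp (-1) * ((Λ j - ν) / Λ j) := by
          rw [Finset.prod_mul_distrib, Finset.prod_const]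
      _ ≤ _ := Finset.prod_le_prod (fun i hi => mul_nonneg (by positivity) (hfac i hi).2)
          fun i hi => (hfac i hi).1
  have hfin : ‖a j0‖ * (Real.exp (-N) * ∏ j ∈ J.erase j0, (Λ j - ν) / Λ j) * Real.exp (-2) ≤
      2 ^ N * M := by
    calc _ ≤ ‖a j0‖ * ‖∏ i ∈ J.erase j0, (s ^ ν - s ^ Λ i)‖ * ‖t ^ ν‖ := by
          gcongr
          · exact hprod.trans (Real.le_norm_self _)
          · exact htν.trans (Real.le_norm_self _)
      _ ≤ _ := hfd
      _ ≤ _ := by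
          gcongr
          norm_num
  have he : Real.exp (N + 2) * (Real.exp (-N) * Real.exp (-2)) = 1 := by
    rw [← Real.exp_add, ← Real.exp_add, Real.exp_eq_one_iff]; ring
  calc _ = Real.exp (N + 2) * (‖a j0‖ * (Real.exp (-N) * ∏ j ∈ J.erase j0, (Λ j - ν) / Λ j) *
        Real.exp (-2)) := by
        linear_combination (-(‖a j0‖ * ∏ j ∈ J.erase j0, (Λ j - ν) / Λ j)) * he
    _ ≤ Real.exp (N + 2) * (2 ^ N * M) := by gcongr
    _ = _ := by ring

lemma lower_integrated (f : ℝ → ℂ) (hf : Continuous f) (N : ℕ) (R X K s : ℝ) (hR : 0 < R)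
    (hX : 0 ≤ X) (hK : 0 ≤ K) (hs0 : 0 < s) (hs1 : s ≤ 1)
    (h : ∀ t M : ℝ, s ^ 2 ≤ t → (∀ k ≤ N, ‖f (t * s ^ k)‖ ≤ M) → X ≤ K * M) :
    X ^ R * (s - s ^ 2) ≤ K ^ R * ((N + 1) * (s ^ N)⁻¹ * ∫ t in (s ^ (N + 2))..s, ‖f t‖ ^ R) := by
  have hc : Continuous fun t => ‖f t‖ ^ R := hf.norm.rpow_const fun _ => Or.inr hR.le
  have hss : s ^ 2 ≤ s := by nlinarith
  have hpt : ∀ t ∈ Icc (s ^ 2) s,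
      X ^ R ≤ K ^ R * ∑ k ∈ Finset.range (N + 1), ‖f (t * s ^ k)‖ ^ R := by
    intro t ht
    set Y := ∑ k ∈ Finset.range (N + 1), ‖f (t * s ^ k)‖ ^ R with hY
    have hY0 : 0 ≤ Y := Finset.sum_nonneg fun k _ => by positivity
    have := h t (Y ^ (1 / R)) ht.1 (fun k hk => by
      have h1 : ‖f (t * s ^ k)‖ ^ R ≤ Y :=
        Finset.single_le_sum (f := fun k => ‖f (t * s ^ k)‖ ^ R) (fun k _ => by positivity)
          (Finset.mem_range.2 (by omega))
      calc ‖f (t * s ^ k)‖ = (‖f (t * s ^ k)‖ ^ R) ^ (1 / R) := by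
            rw [← Real.rpow_mul (norm_nonneg _), mul_one_div_cancel hR.ne', Real.rpow_one]
        _ ≤ _ := by gcongr)
    calc X ^ R ≤ (K * Y ^ (1 / R)) ^ R := by gcongr
      _ = _ := by
        rw [Real.mul_rpow hK (by positivity), ← Real.rpow_mul hY0, one_div_mul_cancel hR.ne',
          Real.rpow_one]
  have hck : ∀ k : ℕ, Continuous fun t => ‖f (t * s ^ k)‖ ^ R := fun k =>
    hc.comp (continuous_id.mul continuous_const)
  calc X ^ R * (s - s ^ 2) = ∫ t in (s ^ 2)..s, X ^ R := by simp [mul_comm]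
    _ ≤ ∫ t in (s ^ 2)..s, K ^ R * ∑ k ∈ Finset.range (N + 1), ‖f (t * s ^ k)‖ ^ R := by
        apply intervalIntegral.integral_mono_on hss
        · simp
        · exact (continuous_const.mul (continuous_finsetSum _ fun k _ => hck k)).intervalIntegrable
            _ _
        · exact hpt
    _ = K ^ R * ∑ k ∈ Finset.range (N + 1), ∫ t in (s ^ 2)..s, ‖f (t * s ^ k)‖ ^ R := by
        rw [intervalIntegral.integral_const_mul, intervalIntegral.integral_finsetSum]
        exact fun k _ => (hck k).intervalIntegrable _ _
    _ ≤ K ^ R * ∑ k ∈ Finset.range (N + 1),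
          ((s ^ N)⁻¹ * ∫ t in (s ^ (N + 2))..s, ‖f t‖ ^ R) := by
        gcongr with k hk
        have hk' : k ≤ N := by have := Finset.mem_range.1 hk; omega
        rw [intervalIntegral.integral_comp_mul_right (fun t => ‖f t‖ ^ R) (by positivity),
          smul_eq_mul]
        have hle : ∫ t in (s ^ 2 * s ^ k)..(s * s ^ k), ‖f t‖ ^ R ≤
            ∫ t in (s ^ (N + 2))..s, ‖f t‖ ^ R := by
          apply intervalIntegral.integral_mono_interval
          · rw [← pow_add]
            exact pow_le_pow_of_le_one hs0.le hs1 (by omega)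
          · gcongr
          · exact mul_le_of_le_one_right hs0.le (pow_le_one₀ hs0.le hs1)
          · exact Eventually.of_forall fun t => by simp only [Pi.zero_apply]; positivity
          · exact hc.intervalIntegrable _ _
        have hnn : 0 ≤ ∫ t in (s ^ 2 * s ^ k)..(s * s ^ k), ‖f t‖ ^ R :=
          intervalIntegral.integral_nonneg (by gcongr) fun t _ => by positivity
        have hpw : s ^ N ≤ s ^ k := pow_le_pow_of_le_one hs0.le hs1 hk'
        gcongr
    _ = _ := by
        rw [Finset.sum_const, Finset.card_range, nsmul_eq_mul]
        push_cast
        ring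

lemma lower_bound (Λ : ℕ → ℝ) (pos : ∀ k, 0 < Λ k) (mono : StrictMono Λ) (N : ℕ)
    (α R : ℝ) (hR : 0 < R) :
    ∃ D : ℝ, 0 < D ∧ ∀ (J : Finset ℕ) (j0 : ℕ), j0 ∈ J → (∀ j ∈ J, j0 ≤ j) → J.card ≤ N + 1 →
      ∀ a : ℕ → ℂ, ENNReal.ofReal (‖a j0‖ * ∏ j ∈ J.erase j0, (Λ j - Λ j0) / Λ j) ≤
        ENNReal.ofReal (D * Λ j0 ^ (α / R)) *
          eLpNorm (mpoly Λ a J) (ENNReal.ofReal R) (nuMeas α) := by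
  set l := Λ 0 with hl
  have hl0 : 0 < l := pos 0
  set κ : ℝ := l / (l + 1) with hκ
  have hκ0 : 0 < κ := by positivity
  set s0 : ℝ := Real.exp (-(1 / l)) with hs00
  have hs0p : 0 < s0 := by positivity
  set c : ℝ := min (κ ^ (α - 1)) ((N + 2 : ℝ) ^ (α - 1)) with hc
  have hc0 : 0 < c := lt_min (by positivity) (by positivity)
  set K : ℝ := Real.exp (N + 2) * 2 ^ N with hK
  have hK0 : 0 < K := by positivity
  set D0 : ℝ := K ^ R * (N + 1) * (s0 ^ N)⁻¹ / (s0 * κ * c) with hD0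
  have hD00 : 0 < D0 := by positivity
  refine ⟨D0 ^ (1 / R), by positivity, ?_⟩
  intro J j0 hj0 hmin hcard a
  set ν := Λ j0 with hν
  have hν0 : 0 < ν := pos j0
  have hlν : l ≤ ν := mono.monotone (Nat.zero_le _)
  set s : ℝ := Real.exp (-(1 / ν)) with hs
  have hsp : 0 < s := by positivity
  have hs1 : s ≤ 1 := by rw [hs, Real.exp_le_one_iff]; simp [hν0.le]
  have hs0s : s0 ≤ s := by
    rw [hs00, hs]; gcongr
  set X : ℝ := ‖a j0‖ * ∏ j ∈ J.erase j0, (Λ j - ν) / Λ j with hX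
  have hX0 : 0 ≤ X := by
    apply mul_nonneg (norm_nonneg _)
    apply Finset.prod_nonneg
    intro i hi
    have : ν ≤ Λ i := mono.monotone (hmin i (Finset.mem_of_mem_erase hi))
    exact div_nonneg (by linarith) (pos i).le
  set f := mpoly Λ a J with hf
  have hfc : Continuous f := mpoly_cont Λ pos a J
  have hinteg := lower_integrated f hfc N R X K s hR hX0 hK0.le hsp hs1
    (fun t M ht hM => lower_pointwise Λ pos mono N J j0 hj0 hmin hcard a s hs t M ht hM)
  set I : ℝ := ∫ t in (s ^ (N + 2))..s, ‖f t‖ ^ R with hI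
  have hcR : Continuous fun t => ‖f t‖ ^ R := hfc.norm.rpow_const fun _ => Or.inr hR.le
  have hpl : s ^ (N + 2) ≤ s := by
    calc s ^ (N + 2) ≤ s ^ 1 := pow_le_pow_of_le_one hsp.le hs1 (by omega)
      _ = s := pow_one s
  have hI0 : 0 ≤ I := intervalIntegral.integral_nonneg hpl fun t _ => by positivity
  have h1s : κ / ν ≤ 1 - s := by
    have h1 : s ≤ ν / (ν + 1) := by
      rw [hs, Real.exp_neg, inv_le_comm₀ (by positivity) (by positivity)]
      calc (ν / (ν + 1))⁻¹ = 1 / ν + 1 := by field_simp; ring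
        _ ≤ _ := Real.add_one_le_exp _
    have h2 : 1 - ν / (ν + 1) = 1 / (ν + 1) := by field_simp; ring
    have h3 : κ / ν ≤ 1 / (ν + 1) := by
      rw [hκ, div_div, div_le_div_iff₀ (by positivity) (by positivity)]
      nlinarith
    linarith
  have h1sN : 1 - s ^ (N + 2) ≤ (N + 2) / ν := by
    have : s ^ (N + 2) = Real.exp (-((N + 2) / ν)) := by
      rw [hs, ← Real.exp_nat_mul]; congr 1; push_cast; ring
    rw [this]
    linarith [Real.add_one_le_exp (-((N + 2) / ν))]
  -- lower bound for the weight
  have hw : ∀ t ∈ Ioc (s ^ (N + 2)) s, c * ν ^ (1 - α) ≤ (1 - t) ^ (α - 1) := by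
    intro t ht
    have ha : κ ≤ (1 - t) * ν := by
      rw [← div_le_iff₀ hν0]; linarith [ht.2]
    have hb : (1 - t) * ν ≤ N + 2 := by
      rw [← le_div_iff₀ hν0]; linarith [ht.1]
    have h1t : 0 < 1 - t := by
      have : 0 < κ / ν := by positivity
      linarith [ht.2]
    have : (1 - t) ^ (α - 1) = ((1 - t) * ν) ^ (α - 1) * ν ^ (1 - α) := by
      rw [Real.mul_rpow h1t.le hν0.le, mul_assoc, ← Real.rpow_add hν0]
      simp
    rw [this]
    gcongr
    rcases le_total 0 (α - 1) with h | h
    · exact (min_le_left _ _).trans (Real.rpow_le_rpow hκ0.le ha h)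
    · exact (min_le_right _ _).trans (Real.rpow_le_rpow_of_nonpos (by positivity) hb h)
  have hnu : ENNReal.ofReal (c * ν ^ (1 - α) * I) ≤ ∫⁻ x, ‖f x‖ₑ ^ R ∂(nuMeas α) := by
    rw [nu_lintegral _ _ (by have := hfc.measurable; fun_prop)]
    calc _ = ∫⁻ t in Ioc (s ^ (N + 2)) s, ENNReal.ofReal (c * ν ^ (1 - α) * ‖f t‖ ^ R) := by
          rw [← ofReal_integral_eq_lintegral_ofReal]
          · rw [integral_const_mul, hI, intervalIntegral.integral_of_le hpl]
          · exact ((intervalIntegrable_iff_integrableOn_Ioc_of_le hpl).1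
              (hcR.intervalIntegrable _ _)).const_mul _
          · exact Eventually.of_forall fun t => by simp only [Pi.zero_apply]; positivity
      _ ≤ ∫⁻ t in Ioc (s ^ (N + 2)) s, ENNReal.ofReal ((1 - t) ^ (α - 1)) * ‖f t‖ₑ ^ R := by
          apply setLIntegral_mono' measurableSet_Ioc
          intro t ht
          rw [← ofReal_norm, ENNReal.ofReal_rpow_of_nonneg (norm_nonneg _) hR.le,
            ← ENNReal.ofReal_mul' (by positivity)]
          apply ENNReal.ofReal_le_ofReal
          gcongr
          exact hw t ht
      _ ≤ _ := by
          apply lintegral_mono_set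
          intro t ht
          exact ⟨(by positivity : 0 ≤ s ^ (N + 2)).trans ht.1.le, ht.2.trans hs1⟩
  have hreal : X ^ R ≤ D0 * ν ^ α * (c * ν ^ (1 - α) * I) := by
    have hA : X ^ R * (s0 * (κ / ν)) ≤ K ^ R * ((N + 1) * (s0 ^ N)⁻¹ * I) := by
      calc X ^ R * (s0 * (κ / ν)) ≤ X ^ R * (s * (1 - s)) := by gcongr
        _ = X ^ R * (s - s ^ 2) := by ring
        _ ≤ _ := hinteg
        _ ≤ _ := by gcongr
    have hν1 : ν ^ α * ν ^ (1 - α) = ν := by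
      rw [← Real.rpow_add hν0]; simp
    calc X ^ R = X ^ R * (s0 * (κ / ν)) * (ν / (s0 * κ)) := by field_simp
      _ ≤ K ^ R * ((N + 1) * (s0 ^ N)⁻¹ * I) * (ν / (s0 * κ)) := by gcongr
      _ = D0 * c * I * ν := by rw [hD0]; field_simp
      _ = D0 * c * I * (ν ^ α * ν ^ (1 - α)) := by rw [hν1]
      _ = _ := by ring
  rw [eLpNorm_eq_lintegral_rpow_enorm_toReal (by simpa using hR) (by simp),
    ENNReal.toReal_ofReal hR.le]
  calc ENNReal.ofReal X = (ENNReal.ofReal (X ^ R)) ^ (1 / R) := by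
        rw [ENNReal.ofReal_rpow_of_nonneg (by positivity) (by positivity), ← Real.rpow_mul hX0,
          mul_one_div_cancel hR.ne', Real.rpow_one]
    _ ≤ (ENNReal.ofReal (D0 * ν ^ α) * ∫⁻ x, ‖f x‖ₑ ^ R ∂(nuMeas α)) ^ (1 / R) := by
        gcongr
        calc _ ≤ ENNReal.ofReal (D0 * ν ^ α * (c * ν ^ (1 - α) * I)) :=
              ENNReal.ofReal_le_ofReal hreal
          _ = ENNReal.ofReal (D0 * ν ^ α) * ENNReal.ofReal (c * ν ^ (1 - α) * I) :=
              ENNReal.ofReal_mul (by positivity)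
          _ ≤ _ := by gcongr
    _ = _ := by
        rw [ENNReal.mul_rpow_of_nonneg _ _ (by positivity),
          ENNReal.ofReal_rpow_of_nonneg (by positivity) (by positivity),
          Real.mul_rpow hD00.le (by positivity), ← Real.rpow_mul hν0.le, mul_one_div]

lemma peel (Λ : ℕ → ℝ) (pos : ∀ k, 0 < Λ k) (mono : StrictMono Λ) (N : ℕ)
    (α R : ℝ) (hα : 0 < α) (hR : 0 < R) :
    ∃ E : ℝ → ℝ, (∀ S, 0 < S → 0 < E S) ∧
      ∀ (J : Finset ℕ) (j0 : ℕ), j0 ∈ J → (∀ j ∈ J, j0 ≤ j) → J.card ≤ N + 1 →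
      ∀ a : ℕ → ℂ, ∃ c : ℕ → ℂ, c j0 = a j0 ∧ ∀ S : ℝ, 0 < S →
        eLpNorm (mpoly Λ c J) (ENNReal.ofReal S) (nuMeas α) ≤
          ENNReal.ofReal (E S * Λ j0 ^ (α / R - α / S)) *
            eLpNorm (mpoly Λ a J) (ENNReal.ofReal R) (nuMeas α) := by
  obtain ⟨D, hD0, hD⟩ := lower_bound Λ pos mono N α R hR
  have hΓ : 0 < Real.Gamma α := Real.Gamma_pos_of_pos hα
  refine ⟨fun S => 2 ^ N * ((2 / S) ^ α * Real.Gamma α) ^ (1 / S) * D,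
    fun S hS => by positivity, ?_⟩
  intro J j0 hj0 hmin hcard a
  have hlt : ∀ j ∈ J.erase j0, j0 < j := fun j hj =>
    lt_of_le_of_ne (hmin j (Finset.mem_of_mem_erase hj)) (Finset.ne_of_mem_erase hj).symm
  obtain ⟨d, hd⟩ := exists_G Λ pos mono j0 (J.erase j0) hlt
  refine ⟨fun j => if j = j0 then a j0 else a j0 * d j, by simp, ?_⟩
  intro S hS
  have hlow := hD J j0 hj0 hmin hcard a
  set W : ℝ := ∏ j ∈ J.erase j0, (Λ j - Λ j0) / Λ j with hW
  have hW0 : 0 ≤ W := Finset.prod_nonneg fun j hj =>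
    div_nonneg (by linarith [mono (hlt j hj)]) (pos j).le
  have hν0 := pos j0
  have hcI : (J.erase j0).card ≤ N := by rw [Finset.card_erase_of_mem hj0]; omega
  have hup := nu_upper α S (Λ j0) (2 ^ N * (‖a j0‖ * W)) hα hS hν0 (by positivity)
    (mpoly Λ (fun j => if j = j0 then a j0 else a j0 * d j) J) (by
      intro t ht
      rcases eq_or_lt_of_le ht.1 with h0 | h0
      · rw [← h0]
        have : mpoly Λ (fun j => if j = j0 then a j0 else a j0 * d j) J 0 = 0 := by
          unfold mpoly
          apply Finset.sum_eq_zero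
          intro j _
          rw [Real.zero_rpow (pos j).ne']
          simp
        rw [this, norm_zero]
        positivity
      have hx : 0 ≤ -Real.log t := by
        have := Real.log_nonpos ht.1 ht.2
        linarith
      have hG := hd (-Real.log t) hx
      have hexp : ∀ b : ℝ, Real.exp (-(b * -Real.log t)) = t ^ b := fun b => by
        rw [Real.rpow_def_of_pos h0]; congr 1; ring
      simp only [hexp] at hG
      have heq : mpoly Λ (fun j => if j = j0 then a j0 else a j0 * d j) J t =
          a j0 * ((t ^ Λ j0 + ∑ j ∈ J.erase j0, d j * t ^ Λ j : ℝ) : ℂ) := by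
        unfold mpoly
        rw [← Finset.add_sum_erase _ _ hj0]
        beta_reduce
        rw [if_pos rfl]
        push_cast
        rw [mul_add, Finset.mul_sum]
        congr 1
        apply Finset.sum_congr rfl
        intro j hj
        beta_reduce
        rw [if_neg (Finset.ne_of_mem_erase hj)]
        ring
      rw [heq, norm_mul, Complex.norm_real, Real.norm_eq_abs]
      calc _ ≤ ‖a j0‖ * (2 ^ N * W * t ^ (Λ j0 / 2)) := by
            gcongr
            refine hG.trans ?_
            gcongr
            norm_num
        _ = _ := by ring)
  refine hup.trans ?_
  calc _ = ENNReal.ofReal (2 ^ N * ((2 / S) ^ α * Real.Gamma α) ^ (1 / S) *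
        Λ j0 ^ (-(α / S))) * ENNReal.ofReal (‖a j0‖ * W) := by
        rw [← ENNReal.ofReal_mul (by positivity)]
        congr 1
        ring
    _ ≤ ENNReal.ofReal (2 ^ N * ((2 / S) ^ α * Real.Gamma α) ^ (1 / S) *
        Λ j0 ^ (-(α / S))) * (ENNReal.ofReal (D * Λ j0 ^ (α / R)) *
          eLpNorm (mpoly Λ a J) (ENNReal.ofReal R) (nuMeas α)) := by gcongr
    _ = _ := by
        rw [← mul_assoc, ← ENNReal.ofReal_mul (by positivity)]
        congr 2
        rw [sub_eq_add_neg, Real.rpow_add hν0]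
        ring

lemma mpoly_finite (Λ : ℕ → ℝ) (pos : ∀ k, 0 < Λ k) (mono : StrictMono Λ)
    (α R : ℝ) (hα : 0 < α) (hR : 0 < R) (a : ℕ → ℂ) (J : Finset ℕ) :
    eLpNorm (mpoly Λ a J) (ENNReal.ofReal R) (nuMeas α) ≠ ⊤ := by
  have := nu_upper α R (Λ 0) (∑ j ∈ J, ‖a j‖) hα hR (pos 0)
    (Finset.sum_nonneg fun _ _ => norm_nonneg _) (mpoly Λ a J) (by
      intro t ht
      unfold mpoly
      rw [Finset.sum_mul]
      refine (norm_sum_le _ _).trans (Finset.sum_le_sum fun j _ => ?_)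
      rw [norm_mul, Complex.norm_real, Real.norm_of_nonneg (Real.rpow_nonneg ht.1 _)]
      refine mul_le_mul_of_nonneg_left ?_ (norm_nonneg _)
      apply Real.rpow_le_rpow_of_exponent_ge' ht.1 ht.2 (by linarith [pos 0])
      linarith [mono.monotone (Nat.zero_le j), pos 0])
  exact ne_top_of_le_ne_top ENNReal.ofReal_ne_top this

lemma mpoly_mem_block (Λ : ℕ → ℝ) (n : ℕ → ℕ) (k : ℕ) (a : ℕ → ℂ) (J : Finset ℕ)
    (hJ : J ⊆ Finset.Ico (n k) (n (k + 1))) : mpoly Λ a J ∈ BlockSpace Λ n k := by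
  refine ⟨fun j => if j ∈ J then a j else 0, ?_⟩
  funext t
  unfold mpoly
  rw [← Finset.sum_subset hJ]
  · exact Finset.sum_congr rfl fun j hj => by simp [hj]
  · intro j _ hj
    simp [hj]

lemma mpoly_mem_muntz (Λ : ℕ → ℝ) (a : ℕ → ℂ) (J : Finset ℕ) : mpoly Λ a J ∈ MuntzPoly Λ := by
  refine ⟨J.sup id, fun j => if j ∈ J then a j else 0, ?_⟩
  funext t
  unfold mpoly
  have hJ : J ⊆ Finset.range (J.sup id + 1) := fun j hj =>
    Finset.mem_range.2 (Nat.lt_succ_of_le (Finset.le_sup (f := id) hj))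
  rw [← Finset.sum_subset hJ]
  · exact Finset.sum_congr rfl fun j hj => by simp [hj]
  · intro j _ hj
    simp [hj]

lemma weak_apply (α β r : ℝ) (hr : 0 < r) (μ : Measure ℝ) (g : ℝ → ℂ) (h : ℝ → ℂ)
    (c X l : ℝ) (hc : 0 ≤ c) (hX : 0 ≤ X) (hl : 0 < l)
    (hg : eLpNorm g (ENNReal.ofReal (r / β)) (nuMeas α) ≤ ENNReal.ofReal X)
    (hw : μ {t : ℝ | l < ‖h t‖} ≤ ENNReal.ofReal (c ^ r * l⁻¹ ^ r) *
        eLpNorm g (ENNReal.ofReal (r / β)) (nuMeas α) ^ r) :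
    μ {t : ℝ | l < ‖h t‖} ≤ ENNReal.ofReal ((c * X) ^ r * l⁻¹ ^ r) := by
  refine hw.trans ?_
  calc _ ≤ ENNReal.ofReal (c ^ r * l⁻¹ ^ r) * (ENNReal.ofReal X) ^ r := by gcongr
    _ = _ := by
      rw [ENNReal.ofReal_rpow_of_nonneg hX hr.le, ← ENNReal.ofReal_mul (by positivity),
        Real.mul_rpow hc hX]
      congr 1
      ring

lemma main_ind (Λ : ℕ → ℝ) (n : ℕ → ℕ) (pos : ∀ k, 0 < Λ k) (mono : StrictMono Λ)
    (α β p q r θ : ℝ) (hα : 0 < α) (hβ : 0 < β)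
    (hp : 1 ≤ p) (hpq : p < q) (hpr : p < r) (hrq : r < q)
    (hθ0 : 0 < θ) (hθ1 : θ < 1) (hθr : 1 / r = (1 - θ) / p + θ / q) (m : ℕ) :
    ∃ C : ℝ, 0 < C ∧
      ∀ (μ : Measure ℝ) (T : (ℝ → ℂ) → ℝ → ℂ) (CpK CqK : ℕ → ℝ),
        SublinearOn Λ μ T →
        (∀ k, 0 ≤ CpK k) → (∀ k, 0 ≤ CqK k) →
        RestrictedWeakType Λ n α β μ T p CpK →
        RestrictedWeakType Λ n α β μ T q CqK →
        ∀ k : ℕ, ∀ J : Finset ℕ, J ⊆ Finset.Ico (n k) (n (k + 1)) → J.card ≤ m → ∀ a : ℕ → ℂ,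
          eLpNorm (T (mpoly Λ a J)) (ENNReal.ofReal r) μ ≤
            ENNReal.ofReal (C * CpK k ^ (1 - θ) * CqK k ^ θ) *
              eLpNorm (mpoly Λ a J) (ENNReal.ofReal (r / β)) (nuMeas α) := by
  have hp0 : 0 < p := by linarith
  have hq0 : 0 < q := by linarith
  have hr0 : 0 < r := by linarith
  have hempty : ∀ (μ : Measure ℝ) (T : (ℝ → ℂ) → ℝ → ℂ), SublinearOn Λ μ T → ∀ a : ℕ → ℂ,
      eLpNorm (T (mpoly Λ a ∅)) (ENNReal.ofReal r) μ = 0 := by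
    intro μ T hT a
    have h0 := hT.2.1 0 _ (mpoly_mem_muntz Λ a ∅)
    have : T (mpoly Λ a ∅) = 0 := by
      funext t
      have h1 := h0 t
      have h2 : (fun x => (0:ℂ) * mpoly Λ a ∅ x) = mpoly Λ a ∅ := by
        funext x; simp [mpoly]
      rw [h2, norm_zero, zero_mul] at h1
      simpa using h1
    rw [this, eLpNorm_zero]
  induction m with
  | zero =>
    refine ⟨1, one_pos, ?_⟩
    intro μ T CpK CqK hT _ _ _ _ k J _ hJ a
    have : J = ∅ := by simpa using hJ
    rw [this, hempty μ T hT a]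
    exact zero_le
  | succ m ih =>
    obtain ⟨C, hC0, hC⟩ := ih
    obtain ⟨E, hE0, hE⟩ := peel Λ pos mono m α (r / β) hα (by positivity)
    set c0 : ℝ := (r / (r - p) + r / (q - r)) ^ (1 / r) with hc0
    have hc00 : 0 < c0 := by
      have h1 : 0 < r - p := by linarith
      have h2 : 0 < q - r := by linarith
      positivity
    have hEp := hE0 (p / β) (by positivity)
    have hEq := hE0 (q / β) (by positivity)
    have hEr := hE0 (r / β) (by positivity)
    set L : ℝ := (ENNReal.LpAddConst (ENNReal.ofReal (r / β))).toReal with hL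
    have hL0 : 0 ≤ L := ENNReal.toReal_nonneg
    refine ⟨c0 * (E (p / β) ^ (1 - θ) * E (q / β) ^ θ) + C * (L * (1 + E (r / β))),
      by positivity, ?_⟩
    intro μ T CpK CqK hT hCp hCq hWp hWq k J hJ hcard a
    rcases J.eq_empty_or_nonempty with hJe | hJne
    · rw [hJe, hempty μ T hT a]
      exact zero_le
    set j0 := J.min' hJne with hj0d
    have hj0 : j0 ∈ J := Finset.min'_mem _ _
    have hmin : ∀ j ∈ J, j0 ≤ j := fun j hj => Finset.min'_le _ _ hj
    obtain ⟨c, hc, hcS⟩ := hE J j0 hj0 hmin hcard a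
    have hν0 := pos j0
    set f := mpoly Λ a J with hf
    set g := mpoly Λ c J with hg
    set f' := mpoly Λ (fun j => a j - c j) (J.erase j0) with hf'
    have hffg : f' = f - g := by
      funext t
      simp only [hf', hf, hg, mpoly, Pi.sub_apply]
      rw [← Finset.sum_sub_distrib, ← Finset.add_sum_erase _ _ hj0, hc]
      rw [sub_self, zero_add]
      exact Finset.sum_congr rfl fun j _ => by ring
    have hfeq : f = g + f' := by rw [hffg]; simp
    have hfin := mpoly_finite Λ pos mono α (r / β) hα (by positivity) a J
    set F := (eLpNorm f (ENNReal.ofReal (r / β)) (nuMeas α)).toReal with hF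
    have hF0 : 0 ≤ F := ENNReal.toReal_nonneg
    have hFe : eLpNorm f (ENNReal.ofReal (r / β)) (nuMeas α) = ENNReal.ofReal F :=
      (ENNReal.ofReal_toReal hfin).symm
    rw [hFe] at hcS ⊢
    have hcp0 := hCp k
    have hcq0 := hCq k
    -- the peeled piece
    have hTg : eLpNorm (T g) (ENNReal.ofReal r) μ ≤ ENNReal.ofReal
        (c0 * (E (p / β) ^ (1 - θ) * E (q / β) ^ θ) * CpK k ^ (1 - θ) * CqK k ^ θ * F) := by
      have hgb : ∀ S : ℝ, 0 < S → eLpNorm g (ENNReal.ofReal S) (nuMeas α) ≤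
          ENNReal.ofReal (E S * Λ j0 ^ (α / (r / β) - α / S) * F) := fun S hS => by
        have := hE0 S hS
        rw [ENNReal.ofReal_mul (by positivity)]
        exact hcS S hS
      have hgm := mpoly_mem_block Λ n k c J hJ
      have := weak_interp p q r θ hp hpq hpr hrq hθ0 hθ1 hθr μ (T g)
        (hT.1 g (mpoly_mem_muntz Λ c J))
        (CpK k * (E (p / β) * Λ j0 ^ (α / (r / β) - α / (p / β)) * F))
        (CqK k * (E (q / β) * Λ j0 ^ (α / (r / β) - α / (q / β)) * F))
        (by positivity) (by positivity)
        (fun l hl => weak_apply α β p hp0 μ g (T g) _ _ l hcp0 (by positivity) hl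
          (hgb _ (by positivity)) (hWp k g hgm l hl))
        (fun l hl => weak_apply α β q hq0 μ g (T g) _ _ l hcq0 (by positivity) hl
          (hgb _ (by positivity)) (hWq k g hgm l hl))
      refine this.trans (le_of_eq ?_)
      congr 1
      have h1 : (Λ j0 ^ (α / (r / β) - α / (p / β))) ^ (1 - θ) *
          (Λ j0 ^ (α / (r / β) - α / (q / β))) ^ θ = 1 := by
        rw [← Real.rpow_mul hν0.le, ← Real.rpow_mul hν0.le, ← Real.rpow_add hν0]
        have : (α / (r / β) - α / (p / β)) * (1 - θ) + (α / (r / β) - α / (q / β)) * θ = 0 := by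
          have e1 : α / (r / β) = α * β * (1 / r) := by field_simp
          have e2 : α / (p / β) = α * β / p := by field_simp
          have e3 : α / (q / β) = α * β / q := by field_simp
          rw [e1, e2, e3, hθr]
          ring
        rw [this, Real.rpow_zero]
      have h2 : F ^ (1 - θ) * F ^ θ = F := by
        rw [← Real.rpow_add_of_nonneg hF0 (by linarith) hθ0.le]
        simp
      rw [Real.mul_rpow hcp0 (by positivity), Real.mul_rpow hcq0 (by positivity),
        Real.mul_rpow (by positivity) hF0, Real.mul_rpow (by positivity) hF0,
        Real.mul_rpow (by positivity) (by positivity),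
        Real.mul_rpow (by positivity) (by positivity)]
      calc _ = c0 * (E (p / β) ^ (1 - θ) * E (q / β) ^ θ) * CpK k ^ (1 - θ) * CqK k ^ θ *
            (F ^ (1 - θ) * F ^ θ) * ((Λ j0 ^ (α / (r / β) - α / (p / β))) ^ (1 - θ) *
          (Λ j0 ^ (α / (r / β) - α / (q / β))) ^ θ) := by ring
        _ = _ := by rw [h1, h2, mul_one]
    -- the remaining piece
    have hf'n : eLpNorm f' (ENNReal.ofReal (r / β)) (nuMeas α) ≤
        ENNReal.ofReal (L * (1 + E (r / β)) * F) := by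
      rw [hffg]
      refine (eLpNorm_sub_le' (mpoly_cont Λ pos a J).aestronglyMeasurable
        (mpoly_cont Λ pos c J).aestronglyMeasurable _).trans ?_
      have hgr := hcS (r / β) (by positivity)
      rw [sub_self, Real.rpow_zero, mul_one] at hgr
      calc _ ≤ ENNReal.ofReal L * (ENNReal.ofReal F + ENNReal.ofReal (E (r / β)) *
            ENNReal.ofReal F) := by
            rw [hL, ENNReal.ofReal_toReal (ENNReal.LpAddConst_lt_top _).ne]
            rw [hFe]
            gcongr
        _ = _ := by
            rw [← ENNReal.ofReal_mul hEr.le, ← ENNReal.ofReal_add hF0 (by positivity),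
              ← ENNReal.ofReal_mul hL0]
            congr 1
            ring
    have hTf' : eLpNorm (T f') (ENNReal.ofReal r) μ ≤ ENNReal.ofReal
        (C * (L * (1 + E (r / β))) * CpK k ^ (1 - θ) * CqK k ^ θ * F) := by
      refine (hC μ T CpK CqK hT hCp hCq hWp hWq k (J.erase j0)
        ((Finset.erase_subset _ _).trans hJ)
        (by rw [Finset.card_erase_of_mem hj0]; omega) (fun j => a j - c j)).trans ?_
      calc _ ≤ ENNReal.ofReal (C * CpK k ^ (1 - θ) * CqK k ^ θ) *
            ENNReal.ofReal (L * (1 + E (r / β)) * F) := by gcongr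
        _ = _ := by
            rw [← ENNReal.ofReal_mul (by positivity)]
            congr 1
            ring
    have hmg := mpoly_mem_muntz Λ c J
    have hmf' := mpoly_mem_muntz Λ (fun j => a j - c j) (J.erase j0)
    calc eLpNorm (T f) (ENNReal.ofReal r) μ
        ≤ eLpNorm ((fun t => ‖T g t‖) + fun t => ‖T f' t‖) (ENNReal.ofReal r) μ := by
          apply eLpNorm_mono_real
          intro t
          rw [hfeq]
          exact hT.2.2.1 g hmg f' hmf' t
      _ ≤ eLpNorm (fun t => ‖T g t‖) (ENNReal.ofReal r) μ +
          eLpNorm (fun t => ‖T f' t‖) (ENNReal.ofReal r) μ := by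
          apply eLpNorm_add_le (hT.1 g hmg).norm.aestronglyMeasurable
            (hT.1 f' hmf').norm.aestronglyMeasurable
          rw [ENNReal.one_le_ofReal]
          linarith
      _ = eLpNorm (T g) (ENNReal.ofReal r) μ + eLpNorm (T f') (ENNReal.ofReal r) μ := by
          rw [eLpNorm_norm, eLpNorm_norm]
      _ ≤ _ := add_le_add hTg hTf'
      _ = _ := by
          rw [← ENNReal.ofReal_add (by positivity) (by positivity),
            ← ENNReal.ofReal_mul (by positivity)]
          congr 1
          ring

/-- elementary interpolation lemma: restricted weak type `p` and `q`
imply restricted strong type `r` with constants `C · C_p(k)^{1-θ} C_q(k)^θ`. -/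
theorem muntz_restricted_interpolation
    (Λ : ℕ → ℝ) (n : ℕ → ℕ) (N : ℕ) (α β p q r θ : ℝ)
    (hQL : IsQuasiLacunary Λ n N) (hα : 0 < α) (hβ : 0 < β)
    (hp : 1 ≤ p) (hpq : p < q) (hpr : p < r) (hrq : r < q)
    (hθ0 : 0 < θ) (hθ1 : θ < 1) (hθr : 1 / r = (1 - θ) / p + θ / q) :
    ∃ C : ℝ, 0 < C ∧
      ∀ (μ : MeasureTheory.Measure ℝ), μ (Set.Icc (0:ℝ) 1)ᶜ = 0 →
      ∀ (T : (ℝ → ℂ) → ℝ → ℂ) (CpK CqK : ℕ → ℝ),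
        SublinearOn Λ μ T →
        (∀ k, 0 ≤ CpK k) → (∀ k, 0 ≤ CqK k) →
        RestrictedWeakType Λ n α β μ T p CpK →
        RestrictedWeakType Λ n α β μ T q CqK →
        ∀ k : ℕ, ∀ f ∈ BlockSpace Λ n k,
          MeasureTheory.eLpNorm (T f) (ENNReal.ofReal r) μ ≤
            ENNReal.ofReal (C * CpK k ^ (1 - θ) * CqK k ^ θ) *
              MeasureTheory.eLpNorm f (ENNReal.ofReal (r / β)) (nuMeas α) := by

  obtain ⟨C, hC0, hC⟩ := main_ind Λ n hQL.pos hQL.mono α β p q r θ hα hβ hp hpq hpr hrq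
    hθ0 hθ1 hθr N
  refine ⟨C, hC0, ?_⟩
  intro μ _ T CpK CqK hT hCp hCq hWp hWq k f hf
  obtain ⟨a, rfl⟩ := hf
  exact hC μ T CpK CqK hT hCp hCq hWp hWq k _ (Finset.Subset.refl _)
    (by rw [Nat.card_Ico]; exact hQL.block_le k) a
end

section
/- Let β ≥ 1, r > β, α > 0 and γ > 0, and let Λ = {λ_k}_{k≥0} be a lacunary sequence with ∑_k 1/λ_k < ∞. Then there exists a linear operator T : M_Λ → M_Λ and a constant C such that ‖T(a t^{λ_k})‖_{L^r(dν_{γ−1})} ≤ C ‖a t^{λ_k}‖_{L^{r/β}(dν_{α−1})} for every k ≥ 0 and every a ∈ ℂ (i.e. T is of restricted strong type r with uniformly bounded constants), but there is no constant C′ such that ‖Tf‖_{L^r(dν_{γ−1})} ≤ C′ ‖f‖_{L^{r/β}(dν_{α−1})} for all f ∈ M_Λ (i.e. T is not of strong type r). -/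
open MeasureTheory Set Filter

lemma nu_set_integral (α δ : ℝ) (hα : 0 < α) (hδ : 0 ≤ δ) :
    IntegrableOn (fun t : ℝ => (1 - t) ^ (α - 1)) (Set.Icc (1 - δ) 1) ∧
    ∫ t in Set.Icc (1 - δ) 1, (1 - t) ^ (α - 1) = δ ^ α / α := by
  have h1 : IntervalIntegrable (fun u : ℝ => u ^ (α - 1)) volume 0 δ :=
    intervalIntegral.intervalIntegrable_rpow' (by linarith)
  have h2 := (h1.comp_sub_left 1).symm
  rw [sub_zero] at h2
  constructor
  · rw [integrableOn_Icc_iff_integrableOn_Ioc]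
    exact (intervalIntegrable_iff_integrableOn_Ioc_of_le (by linarith)).1 h2
  · rw [integral_Icc_eq_integral_Ioc, ← intervalIntegral.integral_of_le (by linarith),
      intervalIntegral.integral_comp_sub_left (fun u : ℝ => u ^ (α - 1)) 1]
    rw [sub_self, sub_sub_cancel, integral_rpow (Or.inl (by linarith))]
    simp [hα.ne']

lemma nu_finite (α : ℝ) (hα : 0 < α) : IsFiniteMeasure (nuMeas α) := by
  have h := (nu_set_integral α 1 hα zero_le_one).1
  rw [sub_self] at h
  unfold nuMeas
  exact isFiniteMeasure_withDensity_ofReal h.2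

lemma nu_ae (α : ℝ) : ∀ᵐ t ∂(nuMeas α), t ∈ Set.Icc (0:ℝ) 1 := by
  unfold nuMeas
  exact (withDensity_absolutelyContinuous _ _).ae_le (ae_restrict_mem measurableSet_Icc)

lemma nu_integral (α : ℝ) (F : ℝ → ℝ) :
    ∫ t, F t ∂(nuMeas α) = ∫ t in Set.Icc (0:ℝ) 1, (1 - t) ^ (α - 1) * F t := by
  unfold nuMeas
  have : (fun x : ℝ => ENNReal.ofReal ((1 - x) ^ (α - 1)))
      = fun x : ℝ => ((Real.toNNReal ((1 - x) ^ (α - 1)) : NNReal) : ENNReal) := rfl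
  rw [this, integral_withDensity_eq_integral_smul (by fun_prop)]
  refine setIntegral_congr_fun measurableSet_Icc fun t ht => ?_
  have : 0 ≤ (1 - t) ^ (α - 1) := Real.rpow_nonneg (by linarith [ht.2]) _
  simp [NNReal.smul_def, this]

lemma nu_integrable (α : ℝ) (hα : 0 < α) (F : ℝ → ℝ) (hF : Measurable F) (M : ℝ)
    (hM : ∀ t ∈ Set.Icc (0:ℝ) 1, 0 ≤ F t ∧ F t ≤ M) : Integrable F (nuMeas α) := by
  have := nu_finite α hα
  refine Integrable.of_bound hF.aestronglyMeasurable M ?_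
  filter_upwards [nu_ae α] with t ht
  rw [Real.norm_of_nonneg (hM t ht).1]
  exact (hM t ht).2

lemma rpow_unit (μ : ℝ) (hμ : 0 ≤ μ) (t : ℝ) (ht : t ∈ Set.Icc (0:ℝ) 1) :
    0 ≤ t ^ μ ∧ t ^ μ ≤ 1 :=
  ⟨Real.rpow_nonneg ht.1 _, Real.rpow_le_one ht.1 ht.2 hμ⟩

lemma integrable_rpow_nu (α : ℝ) (hα : 0 < α) (μ : ℝ) (hμ : 0 ≤ μ) :
    Integrable (fun t : ℝ => t ^ μ) (nuMeas α) :=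
  nu_integrable α hα _ (by fun_prop) 1 (rpow_unit μ hμ)

lemma weight_integrable (α : ℝ) (hα : 0 < α) (μ : ℝ) (hμ : 0 ≤ μ) :
    IntegrableOn (fun t : ℝ => (1 - t) ^ (α - 1) * t ^ μ) (Set.Icc (0:ℝ) 1) := by
  have h := (nu_set_integral α 1 hα zero_le_one).1
  rw [sub_self] at h
  refine Integrable.mono' h (by fun_prop) ?_
  filter_upwards [ae_restrict_mem measurableSet_Icc] with t ht
  have h1 : 0 ≤ (1 - t) ^ (α - 1) := Real.rpow_nonneg (by linarith [ht.2]) _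
  have h2 := rpow_unit μ hμ t ht
  rw [Real.norm_of_nonneg (mul_nonneg h1 h2.1)]
  exact mul_le_of_le_one_right h1 h2.2

lemma moment_lower (α : ℝ) (hα : 0 < α) : ∃ c : ℝ, 0 < c ∧ ∀ μ : ℝ, 0 < μ →
    c * (μ + 1) ^ (-α) ≤ ∫ t, t ^ μ ∂(nuMeas α) := by
  refine ⟨(1/2)^α / α / 2, by positivity, fun μ hμ => ?_⟩
  rw [nu_integral]
  set δ : ℝ := 1/2 * (μ+1)⁻¹ with hδ
  have hδ0 : 0 < δ := by positivity
  have hδm : (μ+1) * δ = 1/2 := by rw [hδ]; field_simp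
  have hδ1 : δ ≤ 1 := by nlinarith
  have hsub : Set.Icc (1 - δ) 1 ⊆ Set.Icc (0:ℝ) 1 := Set.Icc_subset_Icc (by linarith) le_rfl
  have hw := weight_integrable α hα μ hμ.le
  obtain ⟨hi, hv⟩ := nu_set_integral α δ hα hδ0.le
  calc (1/2)^α / α / 2 * (μ + 1) ^ (-α) = (δ ^ α / α) * (1/2) := by
        rw [hδ, Real.mul_rpow (by norm_num) (by positivity), Real.rpow_neg (by positivity),
          Real.inv_rpow (by positivity)]; ring
    _ = ∫ t in Set.Icc (1 - δ) 1, (1 - t) ^ (α - 1) * (1/2) := by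
        rw [integral_mul_const, hv]
    _ ≤ ∫ t in Set.Icc (1 - δ) 1, (1 - t) ^ (α - 1) * t ^ μ := by
        refine setIntegral_mono_on (hi.mul_const _) (hw.mono_set hsub) measurableSet_Icc ?_
        intro t ht
        have ht' := hsub ht
        have h1 : 0 ≤ (1 - t) ^ (α - 1) := Real.rpow_nonneg (by linarith [ht.2]) _
        refine mul_le_mul_of_nonneg_left ?_ h1
        have hB := one_add_mul_self_le_rpow_one_add (s := t - 1) (by linarith [ht'.1])
          (p := μ + 1) (by linarith)
        rw [add_sub_cancel] at hB
        have h3 : t ^ (μ+1) ≤ t ^ μ :=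
          Real.rpow_le_rpow_of_exponent_ge' ht'.1 ht'.2 hμ.le (by linarith)
        have : (μ+1) * (1 - t) ≤ (μ+1) * δ :=
          mul_le_mul_of_nonneg_left (by linarith [ht.1]) (by linarith)
        nlinarith
    _ ≤ _ := by
        refine setIntegral_mono_set hw ?_ hsub.eventuallyLE
        filter_upwards [ae_restrict_mem measurableSet_Icc] with t ht
        exact mul_nonneg (Real.rpow_nonneg (by linarith [ht.2]) _) (rpow_unit μ hμ.le t ht).1

lemma moment_upper (α : ℝ) (hα : 0 < α) : ∀ μ : ℝ, 0 < μ →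
    ∫ t, t ^ μ ∂(nuMeas α) ≤ Real.Gamma α * μ ^ (-α) := by
  intro μ hμ
  rw [nu_integral]
  have hG := Real.integral_rpow_mul_exp_neg_mul_Ioi hα hμ
  have hGi : IntegrableOn (fun u : ℝ => u ^ (α - 1) * Real.exp (-(μ * u))) (Set.Ioi 0) := by
    by_contra hcon
    rw [integral_undef hcon] at hG
    have : 0 < (1 / μ) ^ α * Real.Gamma α := by
      have := Real.Gamma_pos_of_pos hα
      positivity
    linarith
  have hsub : Set.Ioc (0:ℝ) 1 ⊆ Set.Ioi 0 := Set.Ioc_subset_Ioi_self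
  have hi1 : IntervalIntegrable (fun u : ℝ => u ^ (α - 1) * Real.exp (-(μ * u))) volume 0 1 :=
    (intervalIntegrable_iff_integrableOn_Ioc_of_le zero_le_one).2 (hGi.mono_set hsub)
  have hi2 := (hi1.comp_sub_left 1).symm
  rw [sub_zero, sub_self] at hi2
  have hi3 : IntegrableOn (fun t : ℝ => (1 - t) ^ (α - 1) * Real.exp (-(μ * (1 - t))))
      (Set.Icc 0 1) := by
    rw [integrableOn_Icc_iff_integrableOn_Ioc]
    exact (intervalIntegrable_iff_integrableOn_Ioc_of_le zero_le_one).1 hi2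
  calc ∫ t in Set.Icc (0:ℝ) 1, (1 - t) ^ (α - 1) * t ^ μ
      ≤ ∫ t in Set.Icc (0:ℝ) 1, (1 - t) ^ (α - 1) * Real.exp (-(μ * (1 - t))) := by
        refine setIntegral_mono_on (weight_integrable α hα μ hμ.le) hi3 measurableSet_Icc ?_
        intro t ht
        have h1 : 0 ≤ (1 - t) ^ (α - 1) := Real.rpow_nonneg (by linarith [ht.2]) _
        refine mul_le_mul_of_nonneg_left ?_ h1
        have h2 : t ≤ Real.exp (-(1 - t)) := by
          have := Real.add_one_le_exp (-(1 - t)); linarith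
        calc t ^ μ ≤ (Real.exp (-(1 - t))) ^ μ := Real.rpow_le_rpow ht.1 h2 hμ.le
          _ = _ := by rw [← Real.exp_mul]; ring_nf
    _ = ∫ u in Set.Ioc (0:ℝ) 1, u ^ (α - 1) * Real.exp (-(μ * u)) := by
        rw [integral_Icc_eq_integral_Ioc, ← intervalIntegral.integral_of_le zero_le_one,
          ← intervalIntegral.integral_of_le zero_le_one,
          intervalIntegral.integral_comp_sub_left
            (fun u : ℝ => u ^ (α - 1) * Real.exp (-(μ * u))) 1]
        simp
    _ ≤ ∫ u in Set.Ioi (0:ℝ), u ^ (α - 1) * Real.exp (-(μ * u)) := by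
        refine setIntegral_mono_set hGi ?_ hsub.eventuallyLE
        filter_upwards [ae_restrict_mem measurableSet_Ioi] with t ht
        have : (0:ℝ) < t := ht
        positivity
    _ = _ := by
        rw [hG, one_div, Real.inv_rpow hμ.le, Real.rpow_neg hμ.le, mul_comm]

lemma half_ineq (p : ℝ) (hp : 1 < p) (a b : ℝ) (ha : 0 ≤ b) (hab : b ≤ a) :
    (a + b) ^ p ≤ a ^ p + p * 2 ^ p * (a ^ (p-1) * b) := by
  rcases eq_or_lt_of_le (ha.trans hab) with h | h
  · have : b = 0 := by linarith
    subst this; subst h; simp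
  have hab0 : 0 < a + b := by linarith
  -- Bernoulli at `a = (a+b)(1 - b/(a+b))`
  have hB := one_add_mul_self_le_rpow_one_add (s := -b/(a+b))
    (by rw [le_div_iff₀ hab0]; linarith) (p := p) hp.le
  have e1 : 1 + -b/(a+b) = a/(a+b) := by field_simp; ring
  rw [e1, Real.div_rpow h.le hab0.le, le_div_iff₀ (by positivity)] at hB
  have e2 : (a+b)^p = (a+b)^(p-1) * (a+b) := by
    rw [← Real.rpow_add_one hab0.ne']; simp
  have e3 : (1 + p * (-b/(a+b))) * (a+b)^p = (a+b)^p - p * b * (a+b)^(p-1) := by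
    rw [e2]; field_simp; ring
  rw [e3] at hB
  have h4 : (a+b)^(p-1) ≤ 2^p * a^(p-1) := by
    calc (a+b)^(p-1) ≤ (2*a)^(p-1) := Real.rpow_le_rpow hab0.le (by linarith) (by linarith)
      _ = 2^(p-1) * a^(p-1) := Real.mul_rpow (by norm_num) h.le
      _ ≤ _ := by
        refine mul_le_mul_of_nonneg_right ?_ (by positivity)
        exact Real.rpow_le_rpow_of_exponent_le (by norm_num) (by linarith)
  have := mul_le_mul_of_nonneg_left h4 (by positivity : 0 ≤ p * b)
  linarith

lemma full_ineq (p : ℝ) (hp : 1 < p) (a b : ℝ) (ha : 0 ≤ a) (hb : 0 ≤ b) :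
    (a + b) ^ p ≤ a ^ p + b ^ p + p * 2 ^ p * (a ^ (p-1) * b + a * b ^ (p-1)) := by
  have h1 : 0 ≤ a ^ p := by positivity
  have h2 : 0 ≤ b ^ p := by positivity
  have h3 : 0 ≤ p * 2 ^ p * (a ^ (p-1) * b) := by positivity
  have h4 : 0 ≤ p * 2 ^ p * (b ^ (p-1) * a) := by positivity
  rcases le_total b a with h | h
  · have := half_ineq p hp a b hb h
    linarith
  · have := half_ineq p hp b a ha h
    rw [add_comm b a] at this
    linarith

/-- The `L^p(dν_{α-1})` norm of `t^l`. -/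
noncomputable def nuNorm (α p l : ℝ) : ℝ := (∫ t, t ^ (p * l) ∂(nuMeas α)) ^ p⁻¹

lemma moment_pos (α : ℝ) (hα : 0 < α) (μ : ℝ) (hμ : 0 < μ) : 0 < ∫ t, t ^ μ ∂(nuMeas α) := by
  obtain ⟨c, hc, h⟩ := moment_lower α hα
  exact lt_of_lt_of_le (by positivity) (h μ hμ)

lemma nuNorm_pos (α p l : ℝ) (hα : 0 < α) (hp : 0 < p) (hl : 0 < l) : 0 < nuNorm α p l :=
  Real.rpow_pos_of_pos (moment_pos α hα _ (by positivity)) _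

lemma eLp_eq (α p : ℝ) (hα : 0 < α) (hp : 0 < p) (F : ℝ → ℝ) (hF : Measurable F) (M : ℝ)
    (hM : ∀ t ∈ Set.Icc (0:ℝ) 1, 0 ≤ F t ∧ F t ≤ M) :
    eLpNorm (fun t => ((F t : ℝ) : ℂ)) (ENNReal.ofReal p) (nuMeas α)
      = ENNReal.ofReal ((∫ t, F t ^ p ∂(nuMeas α)) ^ p⁻¹) := by
  have := nu_finite α hα
  have hmem : MemLp (fun t => ((F t : ℝ) : ℂ)) (ENNReal.ofReal p) (nuMeas α) := by
    refine MemLp.of_bound (by fun_prop) M ?_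
    filter_upwards [nu_ae α] with t ht
    rw [Complex.norm_real, Real.norm_of_nonneg (hM t ht).1]
    exact (hM t ht).2
  rw [hmem.eLpNorm_eq_integral_rpow_norm (by simpa using hp) ENNReal.ofReal_ne_top,
    ENNReal.toReal_ofReal hp.le]
  congr 2
  refine integral_congr_ae ?_
  filter_upwards [nu_ae α] with t ht
  rw [Complex.norm_real, Real.norm_of_nonneg (hM t ht).1]

lemma eLp_mono_eq (α p l : ℝ) (hα : 0 < α) (hp : 0 < p) (hl : 0 < l) :
    eLpNorm (fun t : ℝ => ((t ^ l : ℝ) : ℂ)) (ENNReal.ofReal p) (nuMeas α)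
      = ENNReal.ofReal (nuNorm α p l) := by
  rw [eLp_eq α p hα hp (fun t : ℝ => t ^ l) (by fun_prop) 1 (rpow_unit l hl.le)]
  unfold nuNorm
  congr 2
  refine integral_congr_ae ?_
  filter_upwards [nu_ae α] with t ht
  rw [← Real.rpow_mul ht.1, mul_comm]

lemma moment_small (α p : ℝ) (hα : 0 < α) (hp : 1 < p) (ε : ℝ) (hε : 0 < ε) :
    ∀ᶠ l : ℝ in atTop, (∫ t, t ^ l ∂(nuMeas α)) ≤ ε * nuNorm α p l ∧
      (∫ t, t ^ ((p - 1) * l) ∂(nuMeas α)) ≤ ε * nuNorm α p l ^ (p - 1) := by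
  obtain ⟨c, hc, hlow⟩ := moment_lower α hα
  have hup := moment_upper α hα
  have hp0 : 0 < p := by linarith
  have hp1 : 0 < p - 1 := by linarith
  set c' : ℝ := (c * (p+1) ^ (-α)) ^ p⁻¹ with hc'
  have hc'0 : 0 < c' := by positivity
  have hG := Real.Gamma_pos_of_pos hα
  have t1 : Tendsto (fun l : ℝ => Real.Gamma α * l ^ (-(α * (p-1) / p))) atTop (nhds 0) := by
    simpa using (tendsto_rpow_neg_atTop (y := α * (p-1) / p) (by positivity)).const_mul
      (Real.Gamma α)
  have t2 : Tendsto (fun l : ℝ => Real.Gamma α * (p-1) ^ (-α) * l ^ (-(α / p))) atTop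
      (nhds 0) := by
    simpa using (tendsto_rpow_neg_atTop (y := α / p) (by positivity)).const_mul
      (Real.Gamma α * (p-1) ^ (-α))
  filter_upwards [eventually_ge_atTop 1,
    t1.eventually_le_const (show 0 < ε * c' by positivity),
    t2.eventually_le_const (show 0 < ε * c' ^ (p-1) by positivity)] with l hl h1 h2
  have hl0 : 0 < l := by linarith
  have hN : c' * l ^ (-(α / p)) ≤ nuNorm α p l := by
    have e : c' * l ^ (-(α/p)) = (c * ((p+1) * l) ^ (-α)) ^ p⁻¹ := by
      rw [hc', Real.mul_rpow (by positivity) hl0.le, ← mul_assoc,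
        Real.mul_rpow (x := c * (p+1) ^ (-α)) (by positivity) (by positivity),
        ← Real.rpow_mul hl0.le]
      ring_nf
    rw [e]
    refine Real.rpow_le_rpow (by positivity) ?_ (by positivity)
    refine le_trans ?_ (hlow (p*l) (by positivity))
    refine mul_le_mul_of_nonneg_left ?_ hc.le
    refine Real.rpow_le_rpow_of_nonpos (by positivity) (by linarith) (by linarith)
  constructor
  · calc _ ≤ Real.Gamma α * l ^ (-α) := hup l hl0
      _ = (Real.Gamma α * l ^ (-(α * (p-1) / p))) * l ^ (-(α/p)) := by
        rw [mul_assoc, ← Real.rpow_add hl0]; congr 2; field_simp; ring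
      _ ≤ (ε * c') * l ^ (-(α/p)) := mul_le_mul_of_nonneg_right h1 (by positivity)
      _ = ε * (c' * l ^ (-(α/p))) := by ring
      _ ≤ _ := mul_le_mul_of_nonneg_left hN hε.le
  · have hN2 : (c' * l ^ (-(α / p))) ^ (p-1) ≤ nuNorm α p l ^ (p-1) :=
      Real.rpow_le_rpow (by positivity) hN hp1.le
    calc _ ≤ Real.Gamma α * ((p-1) * l) ^ (-α) := hup _ (by positivity)
      _ = (Real.Gamma α * (p-1) ^ (-α) * l ^ (-(α / p))) * l ^ (-(α/p) * (p-1)) := by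
        rw [Real.mul_rpow hp1.le hl0.le, mul_assoc _ (l ^ _) (l ^ _), ← Real.rpow_add hl0,
          ← mul_assoc]
        congr 2; field_simp; ring
      _ ≤ (ε * c' ^ (p-1)) * l ^ (-(α/p) * (p-1)) := mul_le_mul_of_nonneg_right h2 (by positivity)
      _ = ε * (c' * l ^ (-(α/p))) ^ (p-1) := by
        rw [Real.mul_rpow hc'0.le (by positivity), ← Real.rpow_mul hl0.le]; ring
      _ ≤ _ := mul_le_mul_of_nonneg_left hN2 hε.le

lemma step_bound (α p : ℝ) (hα : 0 < α) (hp : 1 < p) (F : ℝ → ℝ) (hF : Measurable F) (M : ℝ)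
    (hM : ∀ t ∈ Set.Icc (0:ℝ) 1, 0 ≤ F t ∧ F t ≤ M) :
    ∀ᶠ l : ℝ in atTop,
      ∫ t, (F t + (nuNorm α p l)⁻¹ * t ^ l) ^ p ∂(nuMeas α)
        ≤ (∫ t, F t ^ p ∂(nuMeas α)) + 2 := by
  have hM0 : 0 ≤ M := (hM 0 (by simp)).1.trans (hM 0 (by simp)).2
  have hp0 : 0 < p := by linarith
  have hp1 : 0 < p - 1 := by linarith
  set D : ℝ := p * 2 ^ p with hD
  have hD0 : 0 < D := by positivity
  set ε : ℝ := (D * (M ^ (p-1) + M) + 1)⁻¹ with hε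
  have hε0 : 0 < ε := by positivity
  have hε1 : D * (M ^ (p-1) * ε + M * ε) ≤ 1 := by
    have : (D * (M ^ (p-1) + M) + 1) * ε = 1 := mul_inv_cancel₀ (by positivity)
    nlinarith
  filter_upwards [eventually_gt_atTop 0, moment_small α p hα hp ε hε0] with l hl0 ⟨h1, h2⟩
  set N := nuNorm α p l with hN
  have hN0 : 0 < N := nuNorm_pos α p l hα hp0 hl0
  have hNp : N ^ p = ∫ t, t ^ (p * l) ∂(nuMeas α) := by
    rw [hN, nuNorm, ← Real.rpow_mul (moment_pos α hα _ (by positivity)).le,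
      inv_mul_cancel₀ hp0.ne', Real.rpow_one]
  have iF : Integrable (fun t => F t ^ p) (nuMeas α) := by
    refine nu_integrable α hα _ (by fun_prop) (M ^ p) fun t ht => ?_
    exact ⟨Real.rpow_nonneg (hM t ht).1 _, Real.rpow_le_rpow (hM t ht).1 (hM t ht).2 hp0.le⟩
  have iL : Integrable (fun t => (F t + N⁻¹ * t ^ l) ^ p) (nuMeas α) := by
    refine nu_integrable α hα _ (by fun_prop) ((M + N⁻¹ * 1) ^ p) fun t ht => ?_
    have h3 := hM t ht
    have h4 := rpow_unit l hl0.le t ht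
    have h5 : 0 ≤ F t + N⁻¹ * t ^ l := add_nonneg h3.1 (mul_nonneg (by positivity) h4.1)
    refine ⟨Real.rpow_nonneg h5 _, Real.rpow_le_rpow h5 ?_ hp0.le⟩
    exact add_le_add h3.2 (mul_le_mul_of_nonneg_left h4.2 (by positivity))
  have i1 := integrable_rpow_nu α hα l hl0.le
  have i2 := integrable_rpow_nu α hα (p*l) (by positivity)
  have i3 := integrable_rpow_nu α hα ((p-1)*l) (by positivity)
  have j2 := i2.const_mul (N ^ p)⁻¹
  have j1 := i1.const_mul (D * M ^ (p-1) * N⁻¹)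
  have j3 := i3.const_mul (D * M * (N ^ (p-1))⁻¹)
  calc ∫ t, (F t + N⁻¹ * t ^ l) ^ p ∂(nuMeas α)
      ≤ ∫ t, ((F t ^ p + (N ^ p)⁻¹ * t ^ (p * l)) + (D * M ^ (p-1) * N⁻¹) * t ^ l)
          + (D * M * (N ^ (p-1))⁻¹) * t ^ ((p-1) * l) ∂(nuMeas α) := by
        refine integral_mono_ae iL (((iF.add j2).add j1).add j3) ?_
        filter_upwards [nu_ae α] with t ht
        have h3 := hM t ht
        have h4 := rpow_unit l hl0.le t ht
        have hg : 0 ≤ N⁻¹ * t ^ l := mul_nonneg (by positivity) h4.1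
        have hpow : ∀ s : ℝ, (N⁻¹ * t ^ l) ^ s = (N ^ s)⁻¹ * t ^ (s * l) := by
          intro s
          rw [Real.mul_rpow (by positivity) h4.1, Real.inv_rpow hN0.le, ← Real.rpow_mul ht.1,
            mul_comm l s]
        have hmain := full_ineq p hp (F t) (N⁻¹ * t ^ l) h3.1 hg
        rw [hpow p, hpow (p-1)] at hmain
        have hg2 : 0 ≤ (N ^ (p-1))⁻¹ * t ^ ((p-1) * l) :=
          mul_nonneg (by positivity) (Real.rpow_nonneg ht.1 _)
        have k1 : F t ^ (p-1) * (N⁻¹ * t ^ l) ≤ M ^ (p-1) * (N⁻¹ * t ^ l) :=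
          mul_le_mul_of_nonneg_right (Real.rpow_le_rpow h3.1 h3.2 hp1.le) hg
        have k2 := mul_le_mul_of_nonneg_right h3.2 hg2
        have k3 := mul_le_mul_of_nonneg_left (add_le_add k1 k2) hD0.le
        rw [← hD] at hmain
        linarith
    _ = (∫ t, F t ^ p ∂(nuMeas α)) + (N ^ p)⁻¹ * N ^ p
          + (D * M ^ (p-1) * N⁻¹) * (∫ t, t ^ l ∂(nuMeas α))
          + (D * M * (N ^ (p-1))⁻¹) * (∫ t, t ^ ((p-1) * l) ∂(nuMeas α)) := by
        have m1 : Integrable (fun t => F t ^ p + (N ^ p)⁻¹ * t ^ (p * l)) (nuMeas α) := iF.add j2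
        have m2 : Integrable (fun t => F t ^ p + (N ^ p)⁻¹ * t ^ (p * l)
          + (D * M ^ (p-1) * N⁻¹) * t ^ l) (nuMeas α) := m1.add j1
        rw [integral_add m2 j3, integral_add m1 j1, integral_add iF j2, integral_const_mul, integral_const_mul, integral_const_mul, hNp]
    _ ≤ (∫ t, F t ^ p ∂(nuMeas α)) + 1
          + (D * M ^ (p-1) * N⁻¹) * (ε * N)
          + (D * M * (N ^ (p-1))⁻¹) * (ε * N ^ (p-1)) := by
        rw [inv_mul_cancel₀ (by positivity)]
        gcongr
    _ = (∫ t, F t ^ p ∂(nuMeas α)) + 1 + D * (M ^ (p-1) * ε + M * ε) := by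
        have : 0 < N ^ (p-1) := by positivity
        field_simp
        ring
    _ ≤ _ := by linarith

lemma linIndep (Λ : ℕ → ℝ) (hinj : Function.Injective Λ) :
    LinearIndependent ℂ (fun k : ℕ => fun t : ℝ => ((t ^ (Λ k) : ℝ) : ℂ)) := by
  let R : (ℝ → ℂ) →ₗ[ℂ] (NNReal → ℂ) := LinearMap.funLeft ℂ ℂ (fun x : NNReal => (x : ℝ))
  refine LinearIndependent.of_comp R ?_
  let φ : ℕ → (NNReal →* ℂ) := fun k =>
    { toFun := fun x => (((x : ℝ) ^ (Λ k) : ℝ) : ℂ)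
      map_one' := by simp
      map_mul' := fun x y => by
        rw [NNReal.coe_mul, Real.mul_rpow x.coe_nonneg y.coe_nonneg, Complex.ofReal_mul] }
  have hφ : Function.Injective φ := by
    intro i j hij
    have h := DFunLike.congr_fun hij (2 : NNReal)
    have h' : ((2:ℝ) ^ (Λ i) : ℝ) = (2:ℝ) ^ (Λ j) := by
      have : ((((2 : NNReal) : ℝ) ^ (Λ i) : ℝ) : ℂ) = ((((2 : NNReal) : ℝ) ^ (Λ j) : ℝ) : ℂ) := h
      simpa using Complex.ofReal_injective this
    apply hinj
    exact (Real.rpow_right_inj (by norm_num) (by norm_num)).1 h'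
  exact (linearIndependent_monoidHom NNReal ℂ).comp φ hφ

lemma exists_functional (Λ : ℕ → ℝ) (hinj : Function.Injective Λ) (N : ℕ → ℝ) :
    ∃ L : (ℝ → ℂ) →ₗ[ℂ] ℂ, ∀ k, L (fun t : ℝ => ((t ^ (Λ k) : ℝ) : ℂ)) = (N k : ℂ) := by
  have h := linIndep Λ hinj
  obtain ⟨g, hg⟩ := LinearMap.exists_leftInverse_of_injective
    (Finsupp.linearCombination ℂ (fun k : ℕ => fun t : ℝ => ((t ^ (Λ k) : ℝ) : ℂ)))
    (LinearMap.ker_eq_bot.2 h)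
  refine ⟨(Finsupp.linearCombination ℂ (fun k => (N k : ℂ))).comp g, fun k => ?_⟩
  have := LinearMap.congr_fun hg (Finsupp.single k 1)
  simp only [LinearMap.comp_apply, Finsupp.linearCombination_single, one_smul,
    LinearMap.id_apply] at this
  simp [this]

lemma muntz_add_mono (Λ : ℕ → ℝ) (f : ℝ → ℂ) (hf : f ∈ MuntzPoly Λ) (c : ℂ) (j : ℕ) :
    (f + c • fun t : ℝ => ((t ^ (Λ j) : ℝ) : ℂ)) ∈ MuntzPoly Λ := by
  obtain ⟨K, a, rfl⟩ := hf
  refine ⟨max K j, fun k => (if k ∈ Finset.range (K+1) then a k else 0) + if k = j then c else 0, ?_⟩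
  funext t
  simp only [Pi.add_apply, Pi.smul_apply, smul_eq_mul, add_mul, Finset.sum_add_distrib, ite_mul,
    zero_mul]
  congr 1
  · rw [← Finset.sum_filter]
    refine Finset.sum_congr ?_ fun _ _ => rfl
    ext k
    simp only [Finset.mem_range, Finset.mem_filter]
    omega
  · rw [Finset.sum_ite_eq', if_pos]
    simp only [Finset.mem_range]
    omega

lemma build (α p : ℝ) (hα : 0 < α) (hp : 1 < p) (Λ : ℕ → ℝ) (hpos : ∀ k, 0 < Λ k)
    (hlim : Tendsto Λ atTop atTop) (L : (ℝ → ℂ) →ₗ[ℂ] ℂ)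
    (hL : ∀ k, L (fun t : ℝ => ((t ^ (Λ k) : ℝ) : ℂ)) = (nuNorm α p (Λ k) : ℂ)) (n : ℕ) :
    ∃ f ∈ MuntzPoly Λ, L f = n ∧ ∃ F : ℝ → ℝ, ∃ M : ℝ, Measurable F ∧
      (∀ t ∈ Set.Icc (0:ℝ) 1, 0 ≤ F t ∧ F t ≤ M) ∧ (f = fun t => ((F t : ℝ) : ℂ)) ∧
      ∫ t, F t ^ p ∂(nuMeas α) ≤ 2 * n := by
  have hp0 : 0 < p := by linarith
  induction n with
  | zero =>
    refine ⟨0, ⟨0, fun _ => 0, by funext t; simp⟩, by simp, fun _ => 0, 0, measurable_const,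
      by simp, by funext t; simp, ?_⟩
    simp [Real.zero_rpow hp0.ne']
  | succ n ih =>
    obtain ⟨f, hf, hLf, F, M, hF, hM, hfF, hint⟩ := ih
    obtain ⟨k, hk⟩ := (hlim.eventually (step_bound α p hα hp F hF M hM)).exists
    set N := nuNorm α p (Λ k) with hN
    have hN0 : 0 < N := nuNorm_pos α p _ hα hp0 (hpos k)
    refine ⟨_, muntz_add_mono Λ f hf ((N⁻¹ : ℝ) : ℂ) k, ?_, fun t => F t + N⁻¹ * t ^ (Λ k),
      M + N⁻¹ * 1, by fun_prop, ?_, ?_, ?_⟩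
    · rw [map_add, map_smul, hLf, hL k, ← hN, smul_eq_mul, ← Complex.ofReal_mul,
        inv_mul_cancel₀ hN0.ne']
      simp
    · intro t ht
      have h3 := hM t ht
      have h4 := rpow_unit (Λ k) (hpos k).le t ht
      exact ⟨add_nonneg h3.1 (mul_nonneg (by positivity) h4.1),
        add_le_add h3.2 (mul_le_mul_of_nonneg_left h4.2 (by positivity))⟩
    · funext t
      simp [hfF]
    · push_cast
      linarith

/-- counter-example, subcritical case: there is a linear operator on
`M_Λ` of restricted strong type `r` with uniformly bounded constants which is not of
strong type `r`. -/
theorem muntz_counterexample_subcritical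
    (β r α γ : ℝ) (hβ : 1 ≤ β) (hr : β < r) (hα : 0 < α) (hγ : 0 < γ)
    (Λ : ℕ → ℝ) (q : ℝ) (hq : 1 < q) (hpos : ∀ k, 0 < Λ k)
    (hlac : ∀ k, q * Λ k ≤ Λ (k + 1)) (hsum : Summable fun k => 1 / Λ k) :
    ∃ T : (ℝ → ℂ) → ℝ → ℂ,
      (∀ f ∈ MuntzPoly Λ, T f ∈ MuntzPoly Λ) ∧
      (∀ f ∈ MuntzPoly Λ, ∀ g ∈ MuntzPoly Λ, T (f + g) = T f + T g) ∧
      (∀ c : ℂ, ∀ f ∈ MuntzPoly Λ, T (fun t => c * f t) = fun t => c * T f t) ∧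
      (∃ C : ℝ, 0 < C ∧ ∀ k : ℕ, ∀ a : ℂ,
        MeasureTheory.eLpNorm (T fun t : ℝ => a * ((t ^ (Λ k) : ℝ) : ℂ))
            (ENNReal.ofReal r) (nuMeas γ) ≤
          ENNReal.ofReal C *
            MeasureTheory.eLpNorm (fun t : ℝ => a * ((t ^ (Λ k) : ℝ) : ℂ))
              (ENNReal.ofReal (r / β)) (nuMeas α)) ∧
      ¬ ∃ C' : ℝ, ∀ f ∈ MuntzPoly Λ,
          MeasureTheory.eLpNorm (T f) (ENNReal.ofReal r) (nuMeas γ) ≤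
            ENNReal.ofReal C' *
              MeasureTheory.eLpNorm f (ENNReal.ofReal (r / β)) (nuMeas α) := by
  have hβ0 : 0 < β := by linarith
  have hr0 : 0 < r := by linarith
  set p : ℝ := r / β with hpdef
  have hp : 1 < p := by rw [hpdef, lt_div_iff₀ hβ0]; linarith
  have hp0 : 0 < p := by linarith
  have hmono : StrictMono Λ := strictMono_nat_of_lt_succ fun k => by
    nlinarith [hlac k, hpos k]
  have hlim : Tendsto Λ atTop atTop := by
    have h1 : Tendsto (fun k => 1 / Λ k) atTop (nhdsWithin 0 (Set.Ioi 0)) := by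
      refine tendsto_nhdsWithin_iff.2 ⟨hsum.tendsto_atTop_zero, Eventually.of_forall fun k => ?_⟩
      exact one_div_pos.2 (hpos k)
    have h2 := h1.inv_tendsto_nhdsGT_zero
    refine h2.congr fun k => ?_
    simp
  obtain ⟨L, hL⟩ := exists_functional Λ hmono.injective (fun k => nuNorm α p (Λ k))
  set v : ℝ → ℂ := fun t : ℝ => ((t ^ (Λ 0) : ℝ) : ℂ) with hv
  set V : ℝ := nuNorm γ r (Λ 0) with hV
  have hV0 : 0 < V := nuNorm_pos γ r _ hγ hr0 (hpos 0)
  have hvn : eLpNorm v (ENNReal.ofReal r) (nuMeas γ) = ENNReal.ofReal V :=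
    eLp_mono_eq γ r (Λ 0) hγ hr0 (hpos 0)
  refine ⟨fun f => L f • v, ?_, ?_, ?_, ⟨V, hV0, ?_⟩, ?_⟩
  · intro f _
    exact ⟨0, fun _ => L f, by funext t; simp [hv]⟩
  · intro f _ g _
    simp only [map_add, add_smul]
  · intro c f _
    have : (fun t => c * f t) = c • f := rfl
    simp only [this, map_smul]
    funext t
    simp [mul_assoc]
  · intro k a
    have e : (fun t : ℝ => a * ((t ^ (Λ k) : ℝ) : ℂ))
        = a • (fun t : ℝ => ((t ^ (Λ k) : ℝ) : ℂ)) := rfl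
    simp only [e]
    rw [map_smul, hL k, eLpNorm_const_smul, eLpNorm_const_smul, hvn,
      eLp_mono_eq α p (Λ k) hα hp0 (hpos k), smul_eq_mul, enorm_mul]
    have : ‖((nuNorm α p (Λ k) : ℝ) : ℂ)‖ₑ = ENNReal.ofReal (nuNorm α p (Λ k)) := by
      rw [← ofReal_norm, Complex.norm_real,
        Real.norm_of_nonneg (nuNorm_pos α p _ hα hp0 (hpos k)).le]
    rw [this]
    apply le_of_eq
    ring
  · rintro ⟨C', hC'⟩
    have key : ∀ n : ℕ, (n : ℝ) * V ≤ max C' 0 * (2 * n) ^ p⁻¹ := by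
      intro n
      obtain ⟨f, hf, hLf, F, M, hF, hM, hfF, hint⟩ := build α p hα hp Λ hpos hlim L hL n
      have h := hC' f hf
      simp only at h
      rw [hLf, eLpNorm_const_smul, hvn, hfF, eLp_eq α p hα hp0 F hF M hM] at h
      have e : ‖(n : ℂ)‖ₑ = ENNReal.ofReal n := by
        rw [← ofReal_norm]; simp
      have hI0 : 0 ≤ ∫ t, F t ^ p ∂(nuMeas α) := by
        refine integral_nonneg_of_ae ?_
        filter_upwards [nu_ae α] with t ht
        exact Real.rpow_nonneg (hM t ht).1 _
      have e2 : ENNReal.ofReal C' = ENNReal.ofReal (max C' 0) := by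
        simp [ENNReal.ofReal, Real.toNNReal]
      rw [e, e2, ← ENNReal.ofReal_mul (Nat.cast_nonneg n),
        ← ENNReal.ofReal_mul (le_max_right _ _),
        ENNReal.ofReal_le_ofReal_iff (mul_nonneg (le_max_right _ _) (by positivity))] at h
      refine h.trans (mul_le_mul_of_nonneg_left ?_ (le_max_right _ _))
      exact Real.rpow_le_rpow hI0 hint (by positivity)
    have hinv : p⁻¹ < 1 := inv_lt_one_of_one_lt₀ hp
    have t1 : Tendsto (fun n : ℕ => max C' 0 * 2 ^ p⁻¹ * (n : ℝ) ^ (-(1 - p⁻¹))) atTop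
        (nhds 0) := by
      simpa using ((tendsto_rpow_neg_atTop (y := 1 - p⁻¹) (by linarith)).comp
        tendsto_natCast_atTop_atTop).const_mul (max C' 0 * 2 ^ p⁻¹)
    obtain ⟨n, hn, hn1⟩ := ((t1.eventually_lt_const hV0).and (eventually_ge_atTop 1)).exists
    have hn0 : (0:ℝ) < n := by exact_mod_cast hn1
    have h := key n
    have h2 := mul_lt_mul_of_pos_left hn hn0
    have e3 : (n : ℝ) * (max C' 0 * 2 ^ p⁻¹ * (n : ℝ) ^ (-(1 - p⁻¹)))
        = max C' 0 * (2 * n) ^ p⁻¹ := by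
      have : (n : ℝ) ^ p⁻¹ = n * (n : ℝ) ^ (-(1 - p⁻¹)) := by
        rw [mul_comm, ← Real.rpow_add_one hn0.ne']; congr 1; ring
      rw [Real.mul_rpow (by norm_num) hn0.le, this]; ring
    linarith
end

section
/- Let 0 < β < 1, r > 1, α > 0 and γ > 0, and let Λ = {λ_k}_{k≥0} be a lacunary sequence with ∑_k 1/λ_k < ∞. Then there exist a linear operator T : M_Λ → M_Λ, positive numbers {ε_k}_{k≥1} with ∑_{k≥1} ε_k < ∞, and a constant C such that ‖T(a t^{λ_k})‖_{L^r(dν_{γ−1})} ≤ C ε_k^{(1−β)/r} ‖a t^{λ_k}‖_{L^{r/β}(dν_{α−1})} for every k ≥ 1 and every a ∈ ℂ, but there is no constant C′ such that ‖Tf‖_{L^r(dν_{γ−1})} ≤ C′ ‖f‖_{L^{r/β}(dν_{α−1})} for all f ∈ M_Λ (i.e. T is not of strong type r). -/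
open MeasureTheory Set Filter

lemma aux_indep (Λ : ℕ → ℝ) (hinj : Function.Injective Λ) (c : ℕ → ℂ) :
    ∃ φ : (ℝ → ℂ) →ₗ[ℂ] ℂ, ∀ k, φ (fun t : ℝ => ((t ^ (Λ k) : ℝ) : ℂ)) = c k := by
  let e : ℕ → ℝ → ℂ := fun k t => ((t ^ (Λ k) : ℝ) : ℂ)
  let R : (ℝ → ℂ) →ₗ[ℂ] (Multiplicative ℝ → ℂ) :=
    LinearMap.funLeft ℂ ℂ (fun x : Multiplicative ℝ => Real.exp (Multiplicative.toAdd x))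
  let M : ℕ → (Multiplicative ℝ →* ℂ) := fun k =>
    { toFun := fun x => ((Real.exp (Λ k * Multiplicative.toAdd x) : ℝ) : ℂ)
      map_one' := by simp
      map_mul' := fun x y => by
        rw [toAdd_mul, mul_add, Real.exp_add]; push_cast; rfl }
  have hM : Function.Injective M := by
    intro i j hij
    have := DFunLike.congr_fun hij (Multiplicative.ofAdd (1:ℝ))
    simp only [M, MonoidHom.coe_mk, OneHom.coe_mk, toAdd_ofAdd, mul_one] at this
    exact hinj (Real.exp_injective (Complex.ofReal_injective this))
  have h1 := (linearIndependent_monoidHom (Multiplicative ℝ) ℂ).comp M hM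
  have h2 : LinearIndependent ℂ e := by
    apply LinearIndependent.of_comp R
    have h3 : (R ∘ e) = ((fun f : Multiplicative ℝ →* ℂ => (f : Multiplicative ℝ → ℂ)) ∘ M) := by
      funext k x
      simp only [R, e, M, Function.comp, LinearMap.funLeft_apply, MonoidHom.coe_mk, OneHom.coe_mk]
      rw [← Real.exp_mul, mul_comm]
    rw [h3]
    exact h1
  obtain ⟨g, hg⟩ := LinearMap.exists_leftInverse_of_injective (Finsupp.linearCombination ℂ e)
    (LinearMap.ker_eq_bot.mpr h2)
  refine ⟨(Finsupp.linearCombination ℂ c) ∘ₗ g, fun k => ?_⟩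
  have := LinearMap.congr_fun hg (Finsupp.single k 1)
  simp only [LinearMap.comp_apply, Finsupp.linearCombination_single, one_smul, LinearMap.id_apply] at this
  show Finsupp.linearCombination ℂ c (g (e k)) = c k
  rw [this]; simp

lemma aux_pow_le (t l : ℝ) (ht : 0 ≤ t) (hl : 0 < l) : t ^ l ≤ Real.exp (-(l * (1 - t))) := by
  have h1 : t ≤ Real.exp (-(1 - t)) := by linarith [Real.add_one_le_exp (-(1-t))]
  refine (Real.rpow_le_rpow ht h1 hl.le).trans (le_of_eq ?_)
  rw [← Real.exp_mul]; congr 1; ring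

lemma aux_upper (b l : ℝ) (hb : 0 < b) (hl : 0 < l) :
    ∫⁻ t in Icc (0:ℝ) 1, ENNReal.ofReal ((1 - t) ^ (b - 1) * t ^ l) ≤
      ENNReal.ofReal (Real.Gamma b * l ^ (-b)) := by
  have hint : IntegrableOn (fun x : ℝ => x ^ (b - 1) * Real.exp (-(l * x))) (Ioi 0) := by
    have := integrableOn_rpow_mul_exp_neg_mul_rpow (s := b - 1) (p := 1) (b := l) (by linarith) one_pos hl
    simpa using this
  have hval := Real.integral_rpow_mul_exp_neg_mul_Ioi hb hl
  have h3 : ENNReal.ofReal (Real.Gamma b * l ^ (-b)) =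
      ∫⁻ x in Ioi (0:ℝ), ENNReal.ofReal (x ^ (b - 1) * Real.exp (-(l * x))) := by
    rw [← ofReal_integral_eq_lintegral_ofReal hint, hval]
    · congr 1
      rw [one_div, Real.inv_rpow hl.le, Real.rpow_neg hl.le, mul_comm]
    · filter_upwards [ae_restrict_mem measurableSet_Ioi] with x hx
      have : (0:ℝ) < x := hx
      simp only [Pi.zero_apply]; positivity
  rw [h3, setLIntegral_congr (Ico_ae_eq_Icc (μ := volume)).symm]
  rw [← lintegral_indicator measurableSet_Ico, ← lintegral_indicator measurableSet_Ioi,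
    ← lintegral_sub_left_eq_self (μ := volume) (fun x : ℝ => (Ioi (0:ℝ)).indicator
      (fun x => ENNReal.ofReal (x ^ (b - 1) * Real.exp (-(l * x)))) x) 1]
  apply lintegral_mono
  intro t
  by_cases ht : t ∈ Ico (0:ℝ) 1
  · have h1 : (1 - t) ∈ Ioi (0:ℝ) := by simp only [mem_Ioi]; linarith [ht.2]
    have h1' : 0 < 1 - t := h1
    simp only [indicator_of_mem ht, indicator_of_mem h1]
    apply ENNReal.ofReal_le_ofReal
    exact mul_le_mul_of_nonneg_left (aux_pow_le t l ht.1 hl) (by positivity)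
  · simp only [indicator_of_notMem ht]; exact zero_le

lemma aux_lower (α m0 : ℝ) (hα : 0 < α) (hm0 : 0 < m0) :
    ∃ κ : ℝ, 0 < κ ∧ ∀ m, m0 ≤ m → ENNReal.ofReal (κ * m ^ (-α)) ≤
      ∫⁻ t in Icc (0:ℝ) 1, ENNReal.ofReal ((1 - t) ^ (α - 1) * t ^ m) := by
  set c := m0 / 2 with hc
  have hc0 : 0 < c := by positivity
  refine ⟨(c/2) ^ α * Real.exp (-2*c) / 2, by positivity, fun m hm => ?_⟩
  have hmp : 0 < m := by linarith
  set h := c / m with hh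
  have hh0 : 0 < h := by positivity
  have hh1 : h ≤ 1/2 := by rw [hh, div_le_iff₀ hmp]; linarith
  have hhm : h * m = c := by rw [hh]; field_simp
  have key : ∀ t ∈ Icc (1-h) (1-h/2), (h/2)^α / h * Real.exp (-2*c) ≤ (1 - t) ^ (α - 1) * t ^ m := by
    intro t ht
    have h1 : 0 < 1 - t := by linarith [ht.2]
    have h2 : 0 < t := by linarith [ht.1]
    apply mul_le_mul _ _ (by positivity) (by positivity)
    · rw [Real.rpow_sub_one h1.ne']
      apply div_le_div₀ (by positivity) _ h1 (by linarith [ht.1])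
      exact Real.rpow_le_rpow (by positivity) (by linarith [ht.2]) hα.le
    · have h3 : (1 - h) ^ m ≤ t ^ m := Real.rpow_le_rpow (by linarith) ht.1 hmp.le
      refine le_trans ?_ h3
      rw [Real.rpow_def_of_pos (by linarith)]
      apply Real.exp_le_exp.mpr
      have h4 := Real.one_sub_inv_le_log_of_pos (x := 1 - h) (by linarith)
      have h5 : -2*h ≤ 1 - (1-h)⁻¹ := by
        have : (1-h)⁻¹ ≤ 1 + 2*h := by
          rw [inv_le_iff_one_le_mul₀ (by linarith)]; nlinarith
        linarith
      have : -2 * c = (-2*h) * m := by rw [← hhm]; ring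
      rw [this]
      exact mul_le_mul_of_nonneg_right (h5.trans h4) hmp.le
  calc ENNReal.ofReal ((c/2) ^ α * Real.exp (-2*c) / 2 * m ^ (-α))
      = ENNReal.ofReal ((h/2)^α / h * Real.exp (-2*c)) * volume (Icc (1-h) (1-h/2)) := by
        rw [Real.volume_Icc, ← ENNReal.ofReal_mul (by positivity)]
        congr 1
        have : h/2 = (c/2) / m := by rw [hh]; ring
        rw [this, Real.div_rpow (by positivity) hmp.le, Real.rpow_neg hmp.le]
        have h6 : (1 - c/2/m - (1 - h)) = h/2 := by rw [← this]; ring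
        rw [h6]; field_simp
    _ = ∫⁻ t in Icc (1-h) (1-h/2), ENNReal.ofReal ((h/2)^α / h * Real.exp (-2*c)) := by
        rw [setLIntegral_const]
    _ ≤ ∫⁻ t in Icc (1-h) (1-h/2), ENNReal.ofReal ((1 - t) ^ (α - 1) * t ^ m) := by
        apply setLIntegral_mono' measurableSet_Icc
        intro t ht
        exact ENNReal.ofReal_le_ofReal (key t ht)
    _ ≤ _ := lintegral_mono_set (Icc_subset_Icc (by linarith) (by linarith))

lemma aux_exp (s : ℝ) (hs : 0 < s) (y : ℝ) (hy : 0 ≤ y) : y ^ s * Real.exp (-y) ≤ s ^ s := by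
  have h1 : y / s ≤ Real.exp (y / s) := by linarith [Real.add_one_le_exp (y/s)]
  have h2 := Real.rpow_le_rpow (by positivity) h1 hs.le
  rw [Real.div_rpow hy hs.le, ← Real.exp_mul, div_mul_cancel₀ _ hs.ne', div_le_iff₀ (by positivity)] at h2
  rw [Real.exp_neg, ← div_eq_mul_inv, div_le_iff₀ (Real.exp_pos _)]
  linarith

/-- Telescoping bound for lacunary sums. -/
lemma aux_lac (d q : ℝ) (hd : 0 < d) (hq : 1 < q) : ∃ A : ℝ, 0 < A ∧
    ∀ y : ℕ → ℝ, (∀ k, 0 < y k) → (∀ k, q * y k ≤ y (k+1)) → ∀ N : ℕ,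
      ∑ k ∈ Finset.range N, y k ^ d * Real.exp (-(y k)) ≤ A := by
  have hQ : 1 < q ^ d := Real.one_lt_rpow hq hd
  set Q := q ^ d with hQd
  set B := 1 + (1+Q) * d^d + Q * (2*d)^(2*d) with hB
  have hB0 : 0 < B := by positivity
  refine ⟨B / (Q - 1), div_pos hB0 (by linarith), fun y hy hlac N => ?_⟩
  let F : ℕ → ℝ := fun k => y k ^ d / (1 + y k ^ d)
  have hF1 : ∀ k, F k ≤ 1 := by
    intro k
    have := Real.rpow_pos_of_pos (hy k) d
    simp only [F]; rw [div_le_one (by linarith)]; linarith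
  have hF0 : ∀ k, 0 ≤ F k := by
    intro k
    have := Real.rpow_pos_of_pos (hy k) d
    simp only [F]; positivity
  have step : ∀ k, y k ^ d * Real.exp (-(y k)) ≤ B / (Q-1) * (F (k+1) - F k) := by
    intro k
    have hz := Real.rpow_pos_of_pos (hy k) d
    set z := y k ^ d with hzd
    have hz1 : Q * z ≤ y (k+1) ^ d := by
      rw [hQd, hzd, ← Real.mul_rpow (by linarith) (hy k).le]
      exact Real.rpow_le_rpow (by have := hy k; positivity) (hlac k) hd.le
    have hFk : Q * z / (1 + Q*z) ≤ F (k+1) := by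
      simp only [F]
      rw [div_le_div_iff₀ (by positivity) (by have := hy (k+1); positivity)]
      nlinarith
    have hE : (1+z)*(1+Q*z) * Real.exp (-(y k)) ≤ B := by
      have e1 := aux_exp d hd (y k) (hy k).le
      have e2 := aux_exp (2*d) (by positivity) (y k) (hy k).le
      have e3 : y k ^ (2*d) = z * z := by rw [hzd, ← Real.rpow_add (hy k)]; ring_nf
      have e0 : Real.exp (-(y k)) ≤ 1 := Real.exp_le_one_iff.mpr (by linarith [hy k])
      rw [e3] at e2
      rw [← hzd] at e1
      have e4 := mul_le_mul_of_nonneg_left e1 (show 0 ≤ 1 + Q by linarith)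
      have e5 := mul_le_mul_of_nonneg_left e2 (show 0 ≤ Q by linarith)
      rw [hB]; linarith
    have hdiff : (Q-1) * z / ((1+z)*(1+Q*z)) ≤ F (k+1) - F k := by
      have : (Q-1) * z / ((1+z)*(1+Q*z)) = Q * z / (1 + Q*z) - z/(1+z) := by
        field_simp; ring
      rw [this]; simp only [F, ← hzd] at *; linarith
    have hQ1 : 0 < Q - 1 := by linarith
    refine le_trans ?_ (mul_le_mul_of_nonneg_left hdiff (by positivity))
    have : B / (Q - 1) * ((Q - 1) * z / ((1 + z) * (1 + Q * z))) = z * (B / ((1 + z) * (1 + Q * z))) := by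
      field_simp
    rw [this]
    apply mul_le_mul_of_nonneg_left _ hz.le
    rw [le_div_iff₀ (by positivity)]; linarith
  calc _ ≤ ∑ k ∈ Finset.range N, B / (Q-1) * (F (k+1) - F k) := Finset.sum_le_sum fun k _ => step k
    _ = B/(Q-1) * (F N - F 0) := by rw [← Finset.mul_sum, Finset.sum_range_sub]
    _ ≤ B/(Q-1) * 1 := by
        apply mul_le_mul_of_nonneg_left _ (div_pos hB0 (by linarith)).le
        linarith [hF1 N, hF0 0]
    _ = _ := mul_one _

lemma aux_sum (α p q : ℝ) (hα : 0 < α) (hp : 1 < p) (hq : 1 < q) (Λ : ℕ → ℝ)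
    (hpos : ∀ k, 0 < Λ k) (hlac : ∀ k, q * Λ k ≤ Λ (k + 1)) :
    ∃ A : ℝ, 0 < A ∧ ∀ N : ℕ,
      ∫⁻ t in Icc (0:ℝ) 1, ENNReal.ofReal ((1 - t) ^ (α - 1) *
        (∑ k ∈ Finset.range N, Λ k ^ (α / p) * t ^ Λ k) ^ p) ≤ ENNReal.ofReal (A * N) := by
  have hp0 : 0 < p := by linarith
  set d := α / (2 * p) with hd
  have hd0 : 0 < d := by positivity
  set b := α - d * (p - 1) with hb
  have hb0 : 0 < b := by
    have : d * p = α / 2 := by rw [hd]; field_simp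
    rw [hb]; nlinarith
  obtain ⟨A0, hA0, hA⟩ := aux_lac d q hd0 hq
  have hG := Real.Gamma_pos_of_pos hb0
  refine ⟨A0 ^ (p - 1) * Real.Gamma b, by positivity, fun N => ?_⟩
  have key : ∀ t ∈ Ico (0:ℝ) 1, (1 - t) ^ (α - 1) *
        (∑ k ∈ Finset.range N, Λ k ^ (α / p) * t ^ Λ k) ^ p ≤
        ∑ k ∈ Finset.range N, A0 ^ (p - 1) * Λ k ^ b * ((1 - t) ^ (b - 1) * t ^ Λ k) := by
    intro t ht
    have ht0 : 0 ≤ t := ht.1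
    have hx : 0 < 1 - t := by linarith [ht.2]
    set x := 1 - t with hxd
    have hw0 : ∀ k, 0 ≤ Λ k ^ d * t ^ Λ k := fun k =>
      mul_nonneg (Real.rpow_nonneg (hpos k).le _) (Real.rpow_nonneg ht0 _)
    have hf0 : ∀ k, 0 ≤ Λ k ^ (α / p - d) := fun k => Real.rpow_nonneg (hpos k).le _
    have hH := Real.inner_le_weight_mul_Lp_of_nonneg (Finset.range N) hp.le
      (fun k => Λ k ^ d * t ^ Λ k) (fun k => Λ k ^ (α / p - d)) hw0 hf0
    have e1 : ∀ k, Λ k ^ d * t ^ Λ k * Λ k ^ (α / p - d) = Λ k ^ (α / p) * t ^ Λ k := by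
      intro k
      rw [mul_right_comm, ← Real.rpow_add (hpos k)]; ring_nf
    have e2 : ∀ k, Λ k ^ d * t ^ Λ k * (Λ k ^ (α / p - d)) ^ p = Λ k ^ b * t ^ Λ k := by
      intro k
      rw [← Real.rpow_mul (hpos k).le, mul_right_comm, ← Real.rpow_add (hpos k)]
      congr 2
      rw [hb]; field_simp; ring
    simp only [e1, e2] at hH
    set W := ∑ k ∈ Finset.range N, Λ k ^ d * t ^ Λ k with hW
    set V := ∑ k ∈ Finset.range N, Λ k ^ b * t ^ Λ k with hV
    have hW0 : 0 ≤ W := Finset.sum_nonneg fun k _ => hw0 k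
    have hV0 : 0 ≤ V := Finset.sum_nonneg fun k _ =>
      mul_nonneg (Real.rpow_nonneg (hpos k).le _) (Real.rpow_nonneg ht0 _)
    have hS0 : 0 ≤ ∑ k ∈ Finset.range N, Λ k ^ (α / p) * t ^ Λ k := Finset.sum_nonneg fun k _ =>
      mul_nonneg (Real.rpow_nonneg (hpos k).le _) (Real.rpow_nonneg ht0 _)
    have hWA : W ≤ A0 * x ^ (-d) := by
      have h1 := hA (fun k => Λ k * x) (fun k => mul_pos (hpos k) hx)
        (fun k => by rw [← mul_assoc]; exact mul_le_mul_of_nonneg_right (hlac k) hx.le) N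
      have h2 : x ^ d * W ≤ A0 := by
        refine le_trans ?_ h1
        rw [hW, Finset.mul_sum]
        apply Finset.sum_le_sum
        intro k _
        rw [Real.mul_rpow (hpos k).le hx.le, ← mul_assoc, mul_comm (x ^ d)]
        exact mul_le_mul_of_nonneg_left (aux_pow_le t _ ht0 (hpos k))
          (mul_nonneg (Real.rpow_nonneg (hpos k).le _) (by positivity))
      rw [Real.rpow_neg hx.le, ← div_eq_mul_inv, le_div_iff₀ (by positivity)]
      linarith
    have hSp : (∑ k ∈ Finset.range N, Λ k ^ (α / p) * t ^ Λ k) ^ p ≤ W ^ (p - 1) * V := by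
      refine (Real.rpow_le_rpow hS0 hH hp0.le).trans (le_of_eq ?_)
      rw [Real.mul_rpow (by positivity) (by positivity), ← Real.rpow_mul hW0, ← Real.rpow_mul hV0,
        inv_mul_cancel₀ hp0.ne', Real.rpow_one]
      congr 2; field_simp
    have hWp : W ^ (p - 1) ≤ A0 ^ (p - 1) * x ^ (-d * (p - 1)) := by
      refine (Real.rpow_le_rpow hW0 hWA (by linarith)).trans (le_of_eq ?_)
      rw [Real.mul_rpow hA0.le (by positivity), ← Real.rpow_mul hx.le]
    calc x ^ (α - 1) * (∑ k ∈ Finset.range N, Λ k ^ (α / p) * t ^ Λ k) ^ p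
        ≤ x ^ (α - 1) * (A0 ^ (p - 1) * x ^ (-d * (p - 1)) * V) := by
          apply mul_le_mul_of_nonneg_left _ (by positivity)
          exact hSp.trans (mul_le_mul_of_nonneg_right hWp hV0)
      _ = A0 ^ (p - 1) * x ^ (b - 1) * V := by
          have : x ^ (b - 1) = x ^ (α - 1) * x ^ (-d * (p - 1)) := by
            rw [← Real.rpow_add hx]; congr 1; rw [hb]; ring
          rw [this]; ring
      _ = _ := by
          rw [hV, Finset.mul_sum]
          apply Finset.sum_congr rfl; intro k _; ring
  have hmeas : ∀ k, Measurable fun t : ℝ =>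
      ENNReal.ofReal ((1 - t) ^ (b - 1) * t ^ Λ k) := fun k => by fun_prop
  rw [setLIntegral_congr (Ico_ae_eq_Icc (μ := volume)).symm]
  calc _ ≤ ∫⁻ t in Ico (0:ℝ) 1, ∑ k ∈ Finset.range N, ENNReal.ofReal (A0 ^ (p - 1) * Λ k ^ b) *
          ENNReal.ofReal ((1 - t) ^ (b - 1) * t ^ Λ k) := by
        apply setLIntegral_mono' measurableSet_Ico
        intro t ht
        refine (ENNReal.ofReal_le_ofReal (key t ht)).trans (le_of_eq ?_)
        have hx : 0 < 1 - t := by linarith [ht.2]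
        have ht0 : 0 ≤ t := ht.1
        rw [ENNReal.ofReal_sum_of_nonneg]
        · apply Finset.sum_congr rfl; intro k _
          rw [ENNReal.ofReal_mul]
          have := hpos k
          positivity
        · intro k _
          have := hpos k
          positivity
    _ = ∑ k ∈ Finset.range N, ENNReal.ofReal (A0 ^ (p - 1) * Λ k ^ b) *
          ∫⁻ t in Icc (0:ℝ) 1, ENNReal.ofReal ((1 - t) ^ (b - 1) * t ^ Λ k) := by
        rw [setLIntegral_congr (Ico_ae_eq_Icc (μ := volume)),
          lintegral_finsetSum _ (fun k _ => (hmeas k).const_mul _)]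
        apply Finset.sum_congr rfl; intro k _
        rw [lintegral_const_mul _ (hmeas k)]
    _ ≤ ∑ k ∈ Finset.range N, ENNReal.ofReal (A0 ^ (p - 1) * Real.Gamma b) := by
        apply Finset.sum_le_sum; intro k _
        have hk := hpos k
        refine (mul_le_mul_right (aux_upper b (Λ k) hb0 hk) _).trans (le_of_eq ?_)
        rw [← ENNReal.ofReal_mul (by positivity)]
        congr 1
        rw [Real.rpow_neg hk.le]; field_simp
    _ = _ := by
        rw [Finset.sum_const, Finset.card_range, nsmul_eq_mul, mul_comm,
          ENNReal.ofReal_mul (p := A0 ^ (p - 1) * Real.Gamma b) (by positivity), ENNReal.ofReal_natCast]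

lemma aux_norm (α p : ℝ) (hp : 0 < p) (g : ℝ → ℝ) (hg : Measurable g)
    (hg0 : ∀ t ∈ Icc (0:ℝ) 1, 0 ≤ g t) :
    eLpNorm (fun t => ((g t : ℝ) : ℂ)) (ENNReal.ofReal p) (nuMeas α) =
      (∫⁻ t in Icc (0:ℝ) 1, ENNReal.ofReal ((1 - t) ^ (α - 1) * g t ^ p)) ^ (1 / p) := by
  rw [eLpNorm_eq_lintegral_rpow_enorm_toReal (by simpa using hp) ENNReal.ofReal_ne_top,
    ENNReal.toReal_ofReal hp.le, nuMeas, lintegral_withDensity_eq_lintegral_mul _ (by fun_prop) (by fun_prop)]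
  congr 1
  apply setLIntegral_congr_fun measurableSet_Icc
  intro t ht
  have h1 : 0 ≤ 1 - t := by linarith [ht.2]
  have h2 := hg0 t ht
  simp only [Pi.mul_apply]
  rw [ENNReal.ofReal_mul (by positivity), ← ENNReal.ofReal_rpow_of_nonneg h2 hp.le]
  congr 2
  rw [← ofReal_norm, Complex.norm_real, Real.norm_of_nonneg h2]

lemma aux_mono (α p l : ℝ) (hp : 0 < p) :
    eLpNorm (fun t : ℝ => ((t ^ l : ℝ) : ℂ)) (ENNReal.ofReal p) (nuMeas α) =
      (∫⁻ t in Icc (0:ℝ) 1, ENNReal.ofReal ((1 - t) ^ (α - 1) * t ^ (l * p))) ^ (1 / p) := by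
  rw [aux_norm α p hp (fun t => t ^ l) (by fun_prop) (fun t ht => Real.rpow_nonneg ht.1 _)]
  congr 1
  apply setLIntegral_congr_fun measurableSet_Icc
  intro t ht
  simp only
  rw [Real.rpow_mul ht.1]

lemma aux_mono_lower (α p l0 : ℝ) (hα : 0 < α) (hp : 0 < p) (hl0 : 0 < l0) :
    ∃ κ : ℝ, 0 < κ ∧ ∀ l, l0 ≤ l → ENNReal.ofReal (κ * l ^ (-(α / p))) ≤
      eLpNorm (fun t : ℝ => ((t ^ l : ℝ) : ℂ)) (ENNReal.ofReal p) (nuMeas α) := by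
  obtain ⟨κ, hκ, h⟩ := aux_lower α (l0 * p) hα (by positivity)
  refine ⟨(κ * p ^ (-α)) ^ (1 / p), by positivity, fun l hl => ?_⟩
  have hlp : 0 < l := by linarith
  rw [aux_mono α p l hp]
  have h1 := ENNReal.rpow_le_rpow (h (l * p) (by gcongr)) (show 0 ≤ 1 / p by positivity)
  refine le_trans (le_of_eq ?_) h1
  rw [ENNReal.ofReal_rpow_of_pos (by positivity)]
  congr 1
  have e1 : κ * (l * p) ^ (-α) = (κ * p ^ (-α)) * l ^ (-α) := by
    rw [Real.mul_rpow hlp.le hp.le]; ring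
  have e2 : -(α / p) = -α * (1 / p) := by ring
  rw [e1, Real.mul_rpow (x := κ * p ^ (-α)) (by positivity) (by positivity), e2, Real.rpow_mul hlp.le]

lemma aux_mono_finite (α p l : ℝ) (hα : 0 < α) (hp : 0 < p) (hl : 0 < l) :
    eLpNorm (fun t : ℝ => ((t ^ l : ℝ) : ℂ)) (ENNReal.ofReal p) (nuMeas α) ≠ ⊤ := by
  rw [aux_mono α p l hp]
  apply ENNReal.rpow_ne_top_of_nonneg (by positivity)
  exact ne_top_of_le_ne_top ENNReal.ofReal_ne_top (aux_upper α (l * p) hα (by positivity))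

/-- counter-example, supercritical case: there is a linear operator on
`M_Λ` of restricted strong type `r` with constants `C ε_k^{(1-β)/r}`, `∑ ε_k < ∞`, which
is not of strong type `r`. -/
theorem muntz_counterexample_supercritical
    (β r α γ : ℝ) (hβ0 : 0 < β) (hβ1 : β < 1) (hr : 1 < r) (hα : 0 < α) (hγ : 0 < γ)
    (Λ : ℕ → ℝ) (q : ℝ) (hq : 1 < q) (hpos : ∀ k, 0 < Λ k)
    (hlac : ∀ k, q * Λ k ≤ Λ (k + 1)) (hsum : Summable fun k => 1 / Λ k) :
    ∃ T : (ℝ → ℂ) → ℝ → ℂ, ∃ ε : ℕ → ℝ,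
      (∀ k, 1 ≤ k → 0 < ε k) ∧ Summable ε ∧
      (∀ f ∈ MuntzPoly Λ, T f ∈ MuntzPoly Λ) ∧
      (∀ f ∈ MuntzPoly Λ, ∀ g ∈ MuntzPoly Λ, T (f + g) = T f + T g) ∧
      (∀ c : ℂ, ∀ f ∈ MuntzPoly Λ, T (fun t => c * f t) = fun t => c * T f t) ∧
      (∃ C : ℝ, 0 < C ∧ ∀ k : ℕ, 1 ≤ k → ∀ a : ℂ,
        MeasureTheory.eLpNorm (T fun t : ℝ => a * ((t ^ (Λ k) : ℝ) : ℂ))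
            (ENNReal.ofReal r) (nuMeas γ) ≤
          ENNReal.ofReal (C * ε k ^ ((1 - β) / r)) *
            MeasureTheory.eLpNorm (fun t : ℝ => a * ((t ^ (Λ k) : ℝ) : ℂ))
              (ENNReal.ofReal (r / β)) (nuMeas α)) ∧
      ¬ ∃ C' : ℝ, ∀ f ∈ MuntzPoly Λ,
          MeasureTheory.eLpNorm (T f) (ENNReal.ofReal r) (nuMeas γ) ≤
            ENNReal.ofReal C' *
              MeasureTheory.eLpNorm f (ENNReal.ofReal (r / β)) (nuMeas α) := by
  set p := r / β with hpd
  have hp : 1 < p := by rw [hpd, one_lt_div hβ0]; linarith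
  have hp0 : 0 < p := by linarith
  have hr0 : 0 < r := by linarith
  have hmono : StrictMono Λ := strictMono_nat_of_lt_succ fun k => by
    have := hpos k; have := hlac k; nlinarith
  -- exponents
  set s := (1 + (r - β) / (1 - β)) / 2 with hs
  have hβ1' : 0 < 1 - β := by linarith
  have hs1 : 1 < s := by
    have : 1 < (r - β) / (1 - β) := by rw [one_lt_div hβ1']; linarith
    rw [hs]; linarith
  set σ := s * ((1 - β) / r) with hσ
  have hσ0 : 0 < σ := by positivity
  have hσ1 : 1 / p < 1 - σ := by
    have h1 : s * (1 - β) = ((1 - β) + (r - β)) / 2 := by rw [hs]; field_simp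
    have h2 : σ = ((1 - β) + (r - β)) / 2 / r := by rw [hσ, ← h1]; ring
    rw [h2, hpd, one_div_div, div_lt_iff₀ hr0, sub_mul, div_mul_cancel₀ _ hr0.ne']
    linarith
  let ε : ℕ → ℝ := fun k => ((k + 1 : ℕ) : ℝ) ^ (-s)
  have hε : ∀ k, ε k ^ ((1 - β) / r) = ((k + 1 : ℕ) : ℝ) ^ (-σ) := by
    intro k
    simp only [ε]
    rw [← Real.rpow_mul (by positivity), hσ]; congr 1; ring
  obtain ⟨φ, hφ⟩ := aux_indep Λ hmono.injective
    (fun k => (((((k + 1 : ℕ) : ℝ) ^ (-σ)) * Λ k ^ (-(α / p)) : ℝ) : ℂ))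
  let E : ℝ → ℂ := fun t => ((t ^ (Λ 0) : ℝ) : ℂ)
  obtain ⟨κ, hκ, hlow⟩ := aux_mono_lower α p (Λ 0) hα hp0 (hpos 0)
  obtain ⟨κ', hκ', hlow'⟩ := aux_mono_lower γ r (Λ 0) hγ hr0 (hpos 0)
  have hEtop : eLpNorm E (ENNReal.ofReal r) (nuMeas γ) ≠ ⊤ :=
    aux_mono_finite γ r (Λ 0) hγ hr0 (hpos 0)
  have hE0 : 0 < (eLpNorm E (ENNReal.ofReal r) (nuMeas γ)).toReal := by
    apply ENNReal.toReal_pos _ hEtop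
    apply ne_of_gt
    refine lt_of_lt_of_le ?_ (hlow' (Λ 0) le_rfl)
    rw [ENNReal.ofReal_pos]
    have := hpos 0
    positivity
  set n0 := (eLpNorm E (ENNReal.ofReal r) (nuMeas γ)).toReal with hn0
  have hEn : eLpNorm E (ENNReal.ofReal r) (nuMeas γ) = ENNReal.ofReal n0 :=
    (ENNReal.ofReal_toReal hEtop).symm
  refine ⟨fun f => φ f • E, ε, ?_, ?_, ?_, ?_, ?_, ?_, ?_⟩
  · intro k _; simp only [ε]; positivity
  · have := (summable_nat_add_iff 1).mpr (Real.summable_nat_rpow.mpr (show -s < -1 by linarith))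
    exact this
  · intro f _
    refine ⟨0, fun _ => φ f, ?_⟩
    funext t
    simp [E]
  · intro f _ g _
    simp only [map_add, add_smul]
  · intro c f _
    have : (fun t => c * f t) = c • f := rfl
    rw [this]
    simp only [map_smul]
    funext t
    simp [mul_assoc]
  · refine ⟨n0 / κ, by positivity, fun k _ a => ?_⟩
    have hk := hpos k
    have h1 : (fun t : ℝ => a * ((t ^ (Λ k) : ℝ) : ℂ)) = a • (fun t : ℝ => ((t ^ (Λ k) : ℝ) : ℂ)) := rfl
    have hck : 0 ≤ ((k + 1 : ℕ) : ℝ) ^ (-σ) * Λ k ^ (-(α / p)) := by positivity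
    rw [h1]
    simp only [map_smul]
    rw [hφ, eLpNorm_const_smul, eLpNorm_const_smul, hEn, hε, smul_eq_mul, enorm_mul]
    have h2 : ‖(((((k + 1 : ℕ) : ℝ) ^ (-σ)) * Λ k ^ (-(α / p)) : ℝ) : ℂ)‖ₑ =
        ENNReal.ofReal (((k + 1 : ℕ) : ℝ) ^ (-σ) * Λ k ^ (-(α / p))) := by
      rw [← ofReal_norm, Complex.norm_real, Real.norm_of_nonneg hck]
    rw [h2, mul_assoc, mul_left_comm (ENNReal.ofReal (n0 / κ * _))]
    apply mul_le_mul_right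
    calc ENNReal.ofReal (((k + 1 : ℕ) : ℝ) ^ (-σ) * Λ k ^ (-(α / p))) * ENNReal.ofReal n0
        = ENNReal.ofReal (n0 / κ * ((k + 1 : ℕ) : ℝ) ^ (-σ)) *
          ENNReal.ofReal (κ * Λ k ^ (-(α / p))) := by
            rw [← ENNReal.ofReal_mul hck, ← ENNReal.ofReal_mul (by positivity)]
            congr 1; field_simp
      _ ≤ _ := by
            apply mul_le_mul_right
            exact hlow (Λ k) (hmono.monotone (Nat.zero_le k))
  · rintro ⟨C', hC'⟩
    obtain ⟨A, hA, hsumA⟩ := aux_sum α p q hα hp hq Λ hpos hlac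
    have main : ∀ N : ℕ, ((N + 1 : ℕ) : ℝ) ^ (1 - σ - 1 / p) * n0 ≤ |C'| * A ^ (1 / p) := by
      intro N
      set f : ℝ → ℂ := fun t => ∑ k ∈ Finset.range (N + 1),
        ((Λ k ^ (α / p) : ℝ) : ℂ) * ((t ^ (Λ k) : ℝ) : ℂ) with hf
      have hfM : f ∈ MuntzPoly Λ := ⟨N, fun k => ((Λ k ^ (α / p) : ℝ) : ℂ), rfl⟩
      have h1 : eLpNorm (φ f • E) (ENNReal.ofReal r) (nuMeas γ) ≤
          ENNReal.ofReal C' * eLpNorm f (ENNReal.ofReal p) (nuMeas α) := hC' f hfM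
      have hfn : eLpNorm f (ENNReal.ofReal p) (nuMeas α) ≤
          ENNReal.ofReal ((A * (N + 1 : ℕ)) ^ (1 / p)) := by
        have : f = fun t => ((∑ k ∈ Finset.range (N + 1), Λ k ^ (α / p) * t ^ Λ k : ℝ) : ℂ) := by
          rw [hf]; funext t; push_cast; rfl
        rw [this, aux_norm α p hp0 _ (by fun_prop)]
        · rw [← ENNReal.ofReal_rpow_of_pos (by positivity)]
          exact ENNReal.rpow_le_rpow (hsumA (N + 1)) (by positivity)
        · intro t ht
          apply Finset.sum_nonneg
          intro k _
          exact mul_nonneg (Real.rpow_nonneg (hpos k).le _) (Real.rpow_nonneg ht.1 _)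
      set D := ∑ k ∈ Finset.range (N + 1), ((k + 1 : ℕ) : ℝ) ^ (-σ) with hD
      have hφf : φ f = ((D : ℝ) : ℂ) := by
        have : f = ∑ k ∈ Finset.range (N + 1),
            ((Λ k ^ (α / p) : ℝ) : ℂ) • (fun t : ℝ => ((t ^ (Λ k) : ℝ) : ℂ)) := by
          rw [hf]; funext t; simp
        rw [this, map_sum, hD, Complex.ofReal_sum]
        apply Finset.sum_congr rfl
        intro k _
        rw [map_smul, hφ, smul_eq_mul, ← Complex.ofReal_mul]
        congr 1
        have := hpos k
        rw [Real.rpow_neg this.le]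
        field_simp
      have hDlow : ((N + 1 : ℕ) : ℝ) ^ (1 - σ) ≤ D := by
        have h2 : ∀ k ∈ Finset.range (N + 1), ((N + 1 : ℕ) : ℝ) ^ (-σ) ≤ ((k + 1 : ℕ) : ℝ) ^ (-σ) := by
          intro k hk
          apply Real.rpow_le_rpow_of_nonpos (by positivity) _ (by linarith)
          have := Finset.mem_range.mp hk
          exact_mod_cast this
        have h3 := Finset.card_nsmul_le_sum _ _ _ h2
        rw [Finset.card_range, nsmul_eq_mul] at h3
        refine le_trans (le_of_eq ?_) h3
        rw [sub_eq_add_neg, Real.rpow_add (by positivity), Real.rpow_one]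
      have hD0 : 0 ≤ D := le_trans (by positivity) hDlow
      rw [hφf, eLpNorm_const_smul, hEn, ← ofReal_norm, Complex.norm_real, Real.norm_of_nonneg hD0,
        ← ENNReal.ofReal_mul hD0] at h1
      have h4 : ENNReal.ofReal (D * n0) ≤
          ENNReal.ofReal (|C'| * (A * (N + 1 : ℕ)) ^ (1 / p)) := by
        rw [ENNReal.ofReal_mul (abs_nonneg _)]
        exact h1.trans (mul_le_mul' (ENNReal.ofReal_le_ofReal (le_abs_self _)) hfn)
      have h5 := (ENNReal.ofReal_le_ofReal_iff (by positivity)).mp h4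
      rw [Real.mul_rpow hA.le (by positivity)] at h5
      have h6 := (mul_le_mul_of_nonneg_right hDlow hE0.le).trans h5
      have hN : (0:ℝ) < ((N + 1 : ℕ) : ℝ) := by positivity
      rw [Real.rpow_sub hN _ (1 / p), div_mul_eq_mul_div, div_le_iff₀ (by positivity)]
      linarith
    have ht : Tendsto (fun N : ℕ => ((N + 1 : ℕ) : ℝ) ^ (1 - σ - 1 / p) * n0) atTop atTop := by
      apply Tendsto.atTop_mul_const hE0
      exact (tendsto_rpow_atTop (by linarith)).comp
        (tendsto_natCast_atTop_atTop.comp (tendsto_add_atTop_nat 1))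
    obtain ⟨N, hN⟩ := (ht.eventually_gt_atTop (|C'| * A ^ (1 / p))).exists
    exact absurd (main N) (not_le.mpr hN)
end

section
/- Let Λ = {λ_k}_{k≥1} be a lacunary sequence with ∑_k 1/λ_k < ∞, let α > 0, β ∈ (0,1), r ∈ [1,∞), and let μ be a positive Borel measure on [0,1]. Let T be a sublinear operator acting on M_Λ which is positive in the sense that for all finitely many nonnegative coefficients a_k ≥ 0 one has ∑_k a_k |T(t^{λ_k})(t)| ≤ |T(∑_k a_k t^{λ_k})(t)| for μ-almost every t ∈ [0,1]. If T is of strong type r, i.e. there is C with ‖Tf‖_{L^r(dμ)} ≤ C ‖f‖_{L^{r/β}(dν_{α−1})} for all f ∈ M_Λ, then ∑_{k≥1} ε_k < ∞, where ε_k := (‖T(t^{λ_k})‖_{L^r(dμ)} / ‖t^{λ_k}‖_{L^{r/β}(dν_{α−1})})^{r/(1−β)}. -/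
open MeasureTheory Set Filter

namespace MuntzAux

lemma rpow_le_exp {b x : ℝ} (hb : 0 < b) (hx : 0 ≤ x) : x ^ b ≤ b ^ b * Real.exp x := by
  have h1 : x / b ≤ Real.exp (x / b) := by linarith [Real.add_one_le_exp (x / b)]
  have h2 : (x / b) ^ b ≤ (Real.exp (x / b)) ^ b :=
    Real.rpow_le_rpow (by positivity) h1 hb.le
  rw [← Real.exp_mul, div_mul_cancel₀ _ hb.ne', Real.div_rpow hx hb.le,
    div_le_iff₀ (by positivity)] at h2
  linarith

/-- Telescoping bound for lacunary sums of `x^a e^{-x}`. -/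
lemma lac_sum_bound (a q : ℝ) (ha : 0 < a) (hq : 1 < q) :
    ∃ C : ℝ, 0 < C ∧ ∀ x : ℕ → ℝ, (∀ k, 0 < x k) → (∀ k, q * x k ≤ x (k + 1)) →
      ∀ n, ∑ k ∈ Finset.range n, x k ^ a * Real.exp (-x k) ≤ C := by
  set Q := q ^ a with hQ
  have hQ1 : 1 < Q := Real.one_lt_rpow hq ha
  set K : ℝ := 2 + 2 * (2 * a) ^ (2 * a) with hK
  have hKpos : 0 < K := by positivity
  refine ⟨K * (Q / (Q - 1)), by have : 0 < Q - 1 := by linarith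
                                positivity, ?_⟩
  intro x hx hl n
  have key : ∀ n, ∑ k ∈ Finset.range n, x k ^ a * Real.exp (-x k) ≤
      K * (Q / (Q - 1)) * (1 - 1 / (1 + x n ^ a)) := by
    intro n
    have hQ0 : 0 < Q - 1 := by linarith
    induction n with
    | zero =>
      simp only [Finset.range_zero, Finset.sum_empty]
      have := Real.rpow_pos_of_pos (hx 0) a
      have h2 : 1 / (1 + x 0 ^ a) ≤ 1 := by
        rw [div_le_one (by positivity)]; linarith
      have : 0 ≤ 1 - 1 / (1 + x 0 ^ a) := by linarith
      positivity
    | succ n ih =>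
      rw [Finset.sum_range_succ]
      have hy := Real.rpow_pos_of_pos (hx n) a
      have hz := Real.rpow_pos_of_pos (hx (n+1)) a
      have hyz : Q * x n ^ a ≤ x (n + 1) ^ a := by
        rw [hQ, ← Real.mul_rpow (by linarith) (hx n).le]
        exact Real.rpow_le_rpow (mul_nonneg (by linarith) (hx n).le) (hl n) ha.le
      have hsq : x n ^ (2 * a) = (x n ^ a) ^ 2 := by
        rw [mul_comm, Real.rpow_mul (hx n).le]; norm_cast
      have he : (1 + x n ^ a) ^ 2 * Real.exp (-x n) ≤ K := by
        have h1 := rpow_le_exp (b := 2 * a) (by linarith) (hx n).le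
        rw [hsq] at h1
        have h3 : (1 + x n ^ a) ^ 2 ≤ K * Real.exp (x n) := by
          have := Real.one_le_exp (hx n).le
          nlinarith [sq_nonneg (1 - x n ^ a)]
        rw [Real.exp_neg, ← div_eq_mul_inv, div_le_iff₀ (Real.exp_pos _)]
        exact h3
      generalize x n ^ a = y at *
      generalize x (n+1) ^ a = z at *
      have hQp : 0 < Q := by linarith
      have h4 : 1 / (1 + z) ≤ 1 / (1 + Q * y) :=
        one_div_le_one_div_of_le (by positivity) (by linarith)
      have h5 : (Q - 1) / Q * (y / (1 + y) ^ 2) ≤ 1 / (1 + y) - 1 / (1 + Q * y) := by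
        have : 1 / (1 + y) - 1 / (1 + Q * y) = (Q - 1) * y / ((1 + y) * (1 + Q * y)) := by
          field_simp; ring
        rw [this, div_mul_div_comm]
        apply div_le_div_of_nonneg_left (by positivity) (by positivity)
        nlinarith [mul_pos hy hQp]
      have h6 : y * Real.exp (-x n) ≤ K * (y / (1 + y) ^ 2) := by
        rw [← mul_div_assoc, le_div_iff₀ (by positivity)]
        nlinarith
      have h7 : K * (y / (1 + y) ^ 2) = K * (Q / (Q - 1)) * ((Q - 1) / Q * (y / (1 + y) ^ 2)) := by
        field_simp
      have h8 : K * (Q / (Q - 1)) * ((Q - 1) / Q * (y / (1 + y) ^ 2)) ≤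
          K * (Q / (Q - 1)) * (1 / (1 + y) - 1 / (1 + z)) := by
        apply mul_le_mul_of_nonneg_left (by linarith) (by positivity)
      nlinarith
  refine (key n).trans ?_
  have hQ0 : 0 < Q - 1 := by linarith
  have := Real.rpow_pos_of_pos (hx n) a
  have h2 : 0 ≤ 1 / (1 + x n ^ a) := by positivity
  have h3 : 0 ≤ K * (Q / (Q - 1)) := by positivity
  nlinarith

lemma rpow_le_exp_sub {t l : ℝ} (ht : 0 < t) (hl : 0 < l) :
    t ^ l ≤ Real.exp (-(l * (1 - t))) := by
  rw [Real.rpow_def_of_pos ht]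
  apply Real.exp_le_exp.mpr
  have := Real.log_le_sub_one_of_pos ht
  nlinarith

lemma lac_sum_bound' (Λ : ℕ → ℝ) (q : ℝ) (hq : 1 < q) (hpos : ∀ k, 0 < Λ k)
    (hlac : ∀ k, q * Λ k ≤ Λ (k + 1)) (a : ℝ) (ha : 0 < a) :
    ∃ C : ℝ, 0 < C ∧ ∀ t ∈ Ioo (0:ℝ) 1, ∀ n,
      ∑ k ∈ Finset.range n, Λ k ^ a * t ^ Λ k ≤ C * (1 - t) ^ (-a) := by
  obtain ⟨C, hC, h⟩ := lac_sum_bound a q ha hq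
  refine ⟨C, hC, fun t ht n => ?_⟩
  have hs : 0 < 1 - t := by linarith [ht.2]
  have := h (fun k => Λ k * (1 - t)) (fun k => mul_pos (hpos k) hs)
    (fun k => by nlinarith [hlac k]) n
  have hsa : 0 < (1 - t) ^ a := Real.rpow_pos_of_pos hs a
  rw [Real.rpow_neg hs.le, ← div_eq_mul_inv, le_div_iff₀ hsa, Finset.sum_mul]
  refine le_trans (Finset.sum_le_sum fun k _ => ?_) this
  rw [Real.mul_rpow (hpos k).le hs.le]
  have h1 := rpow_le_exp_sub ht.1 (hpos k)
  have h2 : 0 < Λ k ^ a := Real.rpow_pos_of_pos (hpos k) a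
  calc Λ k ^ a * t ^ Λ k * (1 - t) ^ a = Λ k ^ a * (1 - t) ^ a * t ^ Λ k := by ring
    _ ≤ _ := mul_le_mul_of_nonneg_left h1 (by positivity)

lemma beta_upper (a l : ℝ) (ha : 0 < a) (hl : 0 < l) :
    ∫⁻ t in Ioo (0:ℝ) 1, ENNReal.ofReal (t ^ l * (1 - t) ^ (a - 1)) ≤
      ENNReal.ofReal (Real.Gamma a * l ^ (-a)) := by
  have hInt : IntegrableOn (fun s : ℝ => s ^ (a - 1) * Real.exp (-(l * s))) (Ioi 0) := by
    have := integrableOn_rpow_mul_exp_neg_mul_rpow (p := 1) (s := a - 1) (b := l)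
      (by linarith) one_pos hl
    simpa using this
  have hval := Real.integral_rpow_mul_exp_neg_mul_Ioi ha hl
  have e1 : Real.Gamma a * l ^ (-a) = ∫ s in Ioi (0:ℝ), s ^ (a - 1) * Real.exp (-(l * s)) := by
    rw [hval, one_div, Real.inv_rpow hl.le, Real.rpow_neg hl.le, mul_comm]
  rw [e1, ofReal_integral_eq_lintegral_ofReal hInt]
  · rw [← lintegral_indicator measurableSet_Ioi, ← lintegral_indicator measurableSet_Ioo,
      ← lintegral_sub_left_eq_self _ (1:ℝ)]
    refine lintegral_mono fun t => ?_
    by_cases ht : 1 - t ∈ Ioo (0:ℝ) 1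
    · have ht' : t ∈ Ioi (0:ℝ) := by have := ht.2; simp; linarith
      rw [indicator_of_mem ht, indicator_of_mem ht']
      apply ENNReal.ofReal_le_ofReal
      have h1 := rpow_le_exp_sub ht.1 hl
      simp only [sub_sub_cancel] at h1 ⊢
      rw [mul_comm]
      exact mul_le_mul_of_nonneg_left h1 (Real.rpow_nonneg (le_of_lt ht') _)
    · rw [indicator_of_notMem ht]; exact zero_le
  · refine (ae_restrict_iff' measurableSet_Ioi).mpr (ae_of_all _ fun s hs => ?_)
    have : (0:ℝ) < s := hs
    simp only [Pi.zero_apply]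
    positivity

lemma lintegral_nu (α : ℝ) (f : ℝ → ENNReal) (hf : Measurable f) :
    ∫⁻ t, f t ∂(nuMeas α) = ∫⁻ t in Ioo (0:ℝ) 1, ENNReal.ofReal ((1 - t) ^ (α - 1)) * f t := by
  rw [nuMeas, lintegral_withDensity_eq_lintegral_mul _ (by fun_prop) hf,
    ← Measure.restrict_congr_set (Ioo_ae_eq_Icc (a := (0:ℝ)) (b := 1))]
  rfl

/-- The upper estimate. -/
lemma upper (Λ : ℕ → ℝ) (q : ℝ) (hq : 1 < q) (hpos : ∀ k, 0 < Λ k)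
    (hlac : ∀ k, q * Λ k ≤ Λ (k + 1)) (α p : ℝ) (hα : 0 < α) (hp : 1 ≤ p) :
    ∃ D : ℝ, 0 < D ∧ ∀ b : ℕ → ℝ, (∀ k, 0 ≤ b k) → ∀ n,
      ∫⁻ t, ENNReal.ofReal (|∑ k ∈ Finset.range n, b k * Λ k ^ (α / p) * t ^ Λ k| ^ p)
        ∂(nuMeas α) ≤ ENNReal.ofReal (D * ∑ k ∈ Finset.range n, b k ^ p) := by
  have hp0 : 0 < p := by linarith
  set a := α / p with ha'
  have ha : 0 < a := by positivity
  obtain ⟨C, hC, h⟩ := lac_sum_bound' Λ q hq hpos hlac a ha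
  refine ⟨C ^ (p - 1) * Real.Gamma a,
    mul_pos (Real.rpow_pos_of_pos hC _) (Real.Gamma_pos_of_pos ha), fun b hb n => ?_⟩
  rw [lintegral_nu _ _ (by fun_prop)]
  have hpt : ∀ t ∈ Ioo (0:ℝ) 1, ENNReal.ofReal ((1 - t) ^ (α - 1)) *
      ENNReal.ofReal (|∑ k ∈ Finset.range n, b k * Λ k ^ a * t ^ Λ k| ^ p) ≤
      ∑ k ∈ Finset.range n, ENNReal.ofReal (C ^ (p - 1) * b k ^ p * Λ k ^ a) *
        ENNReal.ofReal (t ^ Λ k * (1 - t) ^ (a - 1)) := by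
    intro t ht
    have hs : 0 < 1 - t := by linarith [ht.2]
    have hw : ∀ k, 0 ≤ Λ k ^ a * t ^ Λ k := fun k =>
      mul_nonneg (Real.rpow_nonneg (hpos k).le _) (Real.rpow_nonneg ht.1.le _)
    have h1 := Real.inner_le_weight_mul_Lp_of_nonneg (Finset.range n) hp
      (fun k => Λ k ^ a * t ^ Λ k) b hw hb
    have hW : 0 ≤ ∑ k ∈ Finset.range n, Λ k ^ a * t ^ Λ k := Finset.sum_nonneg fun k _ => hw k
    have hV : 0 ≤ ∑ k ∈ Finset.range n, Λ k ^ a * t ^ Λ k * b k ^ p :=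
      Finset.sum_nonneg fun k _ => mul_nonneg (hw k) (Real.rpow_nonneg (hb k) _)
    have h0 : 0 ≤ ∑ k ∈ Finset.range n, Λ k ^ a * t ^ Λ k * b k :=
      Finset.sum_nonneg fun k _ => mul_nonneg (hw k) (hb k)
    have e0 : ∑ k ∈ Finset.range n, b k * Λ k ^ a * t ^ Λ k =
        ∑ k ∈ Finset.range n, Λ k ^ a * t ^ Λ k * b k :=
      Finset.sum_congr rfl fun k _ => by ring
    have h2 : (∑ k ∈ Finset.range n, Λ k ^ a * t ^ Λ k * b k) ^ p ≤
        (C * (1 - t) ^ (-a)) ^ (p - 1) * ∑ k ∈ Finset.range n, Λ k ^ a * t ^ Λ k * b k ^ p := by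
      have h3 := Real.rpow_le_rpow h0 h1 hp0.le
      rw [Real.mul_rpow (Real.rpow_nonneg hW _) (Real.rpow_nonneg hV _), ← Real.rpow_mul hW,
        ← Real.rpow_mul hV, inv_mul_cancel₀ hp0.ne', Real.rpow_one] at h3
      have e : (1 - p⁻¹) * p = p - 1 := by field_simp
      rw [e] at h3
      refine h3.trans (mul_le_mul_of_nonneg_right ?_ hV)
      exact Real.rpow_le_rpow hW (h t ht n) (by linarith)
    have hx : 0 ≤ (1 - t) ^ (α - 1) := Real.rpow_nonneg hs.le _
    have h4 : (1 - t) ^ (α - 1) * (∑ k ∈ Finset.range n, Λ k ^ a * t ^ Λ k * b k) ^ p ≤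
        ∑ k ∈ Finset.range n, C ^ (p - 1) * b k ^ p * Λ k ^ a * (t ^ Λ k * (1 - t) ^ (a - 1)) := by
      refine (mul_le_mul_of_nonneg_left h2 hx).trans (le_of_eq ?_)
      rw [Real.mul_rpow hC.le (Real.rpow_nonneg hs.le _), ← Real.rpow_mul hs.le]
      have e2 : (1 - t) ^ (a - 1) = (1 - t) ^ (α - 1) * (1 - t) ^ (-a * (p - 1)) := by
        rw [← Real.rpow_add hs]; congr 1
        have : a * p = α := by rw [ha']; field_simp
        nlinarith
      rw [e2, Finset.mul_sum, Finset.mul_sum]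
      exact Finset.sum_congr rfl fun k _ => by ring
    rw [← ENNReal.ofReal_mul hx, e0, abs_of_nonneg h0]
    refine (ENNReal.ofReal_le_ofReal h4).trans (le_of_eq ?_)
    have hc : ∀ k, 0 ≤ C ^ (p - 1) * b k ^ p * Λ k ^ a := fun k =>
      mul_nonneg (mul_nonneg (Real.rpow_nonneg hC.le _) (Real.rpow_nonneg (hb k) _))
        (Real.rpow_nonneg (hpos k).le _)
    rw [ENNReal.ofReal_sum_of_nonneg]
    · exact Finset.sum_congr rfl fun k _ => ENNReal.ofReal_mul (hc k)
    · intro k _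
      exact mul_nonneg (hc k) (mul_nonneg (Real.rpow_nonneg ht.1.le _) (Real.rpow_nonneg hs.le _))
  refine (setLIntegral_mono' measurableSet_Ioo hpt).trans ?_
  rw [lintegral_finsetSum _ (fun k _ => by fun_prop)]
  have hc : ∀ k, 0 ≤ C ^ (p - 1) * b k ^ p * Λ k ^ a := fun k =>
      mul_nonneg (mul_nonneg (Real.rpow_nonneg hC.le _) (Real.rpow_nonneg (hb k) _))
        (Real.rpow_nonneg (hpos k).le _)
  have hterm : ∀ k ∈ Finset.range n,
      ∫⁻ t in Ioo (0:ℝ) 1, ENNReal.ofReal (C ^ (p - 1) * b k ^ p * Λ k ^ a) *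
        ENNReal.ofReal (t ^ Λ k * (1 - t) ^ (a - 1)) ≤
      ENNReal.ofReal (C ^ (p - 1) * Real.Gamma a * b k ^ p) := by
    intro k _
    rw [lintegral_const_mul _ (by fun_prop)]
    refine (mul_le_mul_right (beta_upper a (Λ k) ha (hpos k)) _).trans (le_of_eq ?_)
    rw [← ENNReal.ofReal_mul (hc k)]
    congr 1
    have : Λ k ^ a * Λ k ^ (-a) = 1 := by
      rw [← Real.rpow_add (hpos k)]; simp
    linear_combination C ^ (p - 1) * Real.Gamma a * b k ^ p * this
  refine (Finset.sum_le_sum hterm).trans (le_of_eq ?_)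
  rw [← ENNReal.ofReal_sum_of_nonneg, Finset.mul_sum]
  intro k _
  exact mul_nonneg (mul_nonneg (Real.rpow_nonneg hC.le _) (Real.Gamma_pos_of_pos ha).le)
    (Real.rpow_nonneg (hb k) _)

/-- Lower bound on the norm of a monomial. -/
lemma lower (α p l0 : ℝ) (hα : 0 < α) (hp : 0 < p) (hl0 : 0 < l0) :
    ∃ c : ℝ, 0 < c ∧ ∀ l, l0 ≤ l →
      ENNReal.ofReal (c * l ^ (-α)) ≤ ∫⁻ t, ENNReal.ofReal (|t ^ l| ^ p) ∂(nuMeas α) := by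
  set m := l0 / 2 with hm
  have hm0 : 0 < m := by positivity
  set κ : ℝ := Real.exp (-(2 * m * p)) * (1 / 2) ^ |α - 1| with hκ
  have hκ0 : 0 < κ := by positivity
  refine ⟨κ * m ^ α / 2, by positivity, fun l hl => ?_⟩
  have hl1 : 0 < l := by linarith
  set δ := m / l with hδ
  have hδ0 : 0 < δ := by positivity
  have hδ1 : δ ≤ 1 / 2 := by rw [hδ, div_le_iff₀ hl1]; linarith
  rw [lintegral_nu _ _ (by fun_prop)]
  have hsub : Ioo (1 - δ) (1 - δ / 2) ⊆ Ioo (0:ℝ) 1 := by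
    intro t ht; exact ⟨by linarith [ht.1], by linarith [ht.2]⟩
  have hpt : ∀ t ∈ Ioo (1 - δ) (1 - δ / 2), ENNReal.ofReal (κ * δ ^ (α - 1)) ≤
      ENNReal.ofReal ((1 - t) ^ (α - 1)) * ENNReal.ofReal (|t ^ l| ^ p) := by
    intro t ht
    have ht0 : 0 < t := (hsub ht).1
    have hs : 0 < 1 - t := by linarith [(hsub ht).2]
    rw [← ENNReal.ofReal_mul (Real.rpow_nonneg hs.le _)]
    apply ENNReal.ofReal_le_ofReal
    rw [abs_of_nonneg (Real.rpow_nonneg ht0.le _)]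
    have h1 : Real.exp (-(2 * m * p)) ≤ (t ^ l) ^ p := by
      rw [← Real.rpow_mul ht0.le, Real.rpow_def_of_pos ht0]
      apply Real.exp_le_exp.mpr
      have h2 := Real.one_sub_inv_le_log_of_pos ht0
      have h3 : -(2 * δ) ≤ 1 - t⁻¹ := by
        have : t⁻¹ ≤ 1 + 2 * δ := by
          rw [inv_le_comm₀ ht0 (by positivity)]
          refine le_trans ?_ ht.1.le
          rw [inv_le_iff_one_le_mul₀ (by positivity)]
          nlinarith
        linarith
      have h4 : -(2 * δ) * (l * p) ≤ Real.log t * (l * p) :=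
        mul_le_mul_of_nonneg_right (by linarith) (by positivity)
      have h5 : δ * l = m := by rw [hδ]; field_simp
      calc -(2 * m * p) = -(2 * δ) * (l * p) := by rw [← h5]; ring
        _ ≤ _ := h4
    have h6 : (1 / 2) ^ |α - 1| * δ ^ (α - 1) ≤ (1 - t) ^ (α - 1) := by
      set z := (1 - t) / δ with hz
      have hz1 : 1 / 2 ≤ z := by rw [hz, le_div_iff₀ hδ0]; linarith [ht.2]
      have hz2 : z ≤ 1 := by rw [hz, div_le_iff₀ hδ0]; linarith [ht.1]
      have hz0 : 0 < z := by linarith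
      have e : (1 - t) = z * δ := by rw [hz]; field_simp
      rw [e, Real.mul_rpow hz0.le hδ0.le]
      apply mul_le_mul_of_nonneg_right _ (by positivity)
      calc (1 / 2 : ℝ) ^ |α - 1| ≤ z ^ |α - 1| :=
            Real.rpow_le_rpow (by norm_num) hz1 (abs_nonneg _)
        _ ≤ z ^ (α - 1) := Real.rpow_le_rpow_of_exponent_ge hz0 hz2 (le_abs_self _)
    calc κ * δ ^ (α - 1) = ((1 / 2) ^ |α - 1| * δ ^ (α - 1)) * Real.exp (-(2 * m * p)) := by
          rw [hκ]; ring
      _ ≤ _ := mul_le_mul h6 h1 (Real.exp_pos _).le (Real.rpow_nonneg hs.le _)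
  calc ENNReal.ofReal (κ * m ^ α / 2 * l ^ (-α))
      = ENNReal.ofReal (κ * δ ^ (α - 1)) * volume (Ioo (1 - δ) (1 - δ / 2)) := by
        rw [Real.volume_Ioo, ← ENNReal.ofReal_mul (by positivity)]
        congr 1
        have e1 : δ ^ (α - 1) * δ = δ ^ α := by
          rw [Real.rpow_sub_one hδ0.ne']; field_simp
        have e2 : δ ^ α = m ^ α * l ^ (-α) := by
          rw [hδ, Real.div_rpow hm0.le hl1.le, Real.rpow_neg hl1.le]; rfl
        linear_combination (-κ / 2) * e2 - κ / 2 * e1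
    _ = ∫⁻ t in Ioo (1 - δ) (1 - δ / 2), ENNReal.ofReal (κ * δ ^ (α - 1)) := by
        rw [setLIntegral_const]
    _ ≤ ∫⁻ t in Ioo (1 - δ) (1 - δ / 2),
        ENNReal.ofReal ((1 - t) ^ (α - 1)) * ENNReal.ofReal (|t ^ l| ^ p) :=
        setLIntegral_mono' measurableSet_Ioo hpt
    _ ≤ _ := lintegral_mono_set hsub

lemma sum_rpow_le (r : ℝ) (hr : 1 ≤ r) (s : Finset ℕ) (x : ℕ → ℝ) (hx : ∀ k, 0 ≤ x k) :
    ∑ k ∈ s, x k ^ r ≤ (∑ k ∈ s, x k) ^ r := by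
  induction s using Finset.induction_on with
  | empty => simp [Real.zero_rpow (by linarith : r ≠ 0)]
  | insert i s hi ih =>
    rw [Finset.sum_insert hi, Finset.sum_insert hi]
    have := Real.add_rpow_le_rpow_add (hx i) (Finset.sum_nonneg fun k (_ : k ∈ s) => hx k) hr
    linarith

/-- Duality step. -/
lemma dual (β r M : ℝ) (hβ0 : 0 < β) (hβ1 : β < 1) (hr : 1 ≤ r) (u : ℕ → ℝ)
    (hu : ∀ k, 0 ≤ u k)
    (h : ∀ b : ℕ → ℝ, (∀ k, 0 ≤ b k) → ∀ n,
      ∑ k ∈ Finset.range (n + 1), (b k * u k) ^ r ≤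
        M * (∑ k ∈ Finset.range (n + 1), b k ^ (r / β)) ^ β) :
    Summable fun k => u k ^ (r / (1 - β)) := by
  have h1β : 0 < 1 - β := by linarith
  have hr0 : 0 < r := by linarith
  have hnn : ∀ k, 0 ≤ u k ^ (r / (1 - β)) := fun k => Real.rpow_nonneg (hu k) _
  refine summable_of_sum_range_le (c := |M| ^ (1 / (1 - β))) hnn fun n => ?_
  refine (Finset.sum_le_sum_of_subset_of_nonneg
    (Finset.range_mono (Nat.le_succ n)) fun k _ _ => hnn k).trans ?_
  have := h (fun k => u k ^ (β / (1 - β))) (fun k => Real.rpow_nonneg (hu k) _) n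
  have e1 : ∀ k, (u k ^ (β / (1 - β)) * u k) ^ r = u k ^ (r / (1 - β)) := by
    intro k
    rcases (hu k).eq_or_lt with h0 | h0
    · rw [← h0, mul_zero, Real.zero_rpow hr0.ne', Real.zero_rpow (by positivity)]
    · rw [← Real.rpow_add_one h0.ne', ← Real.rpow_mul h0.le]
      congr 1; field_simp; ring
  have e2 : ∀ k, (u k ^ (β / (1 - β))) ^ (r / β) = u k ^ (r / (1 - β)) := by
    intro k
    rw [← Real.rpow_mul (hu k)]
    congr 1; field_simp
  simp only [e1, e2] at this
  change ∑ k ∈ Finset.range (n + 1), u k ^ (r / (1 - β)) ≤ _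
  have hS : 0 ≤ ∑ k ∈ Finset.range (n + 1), u k ^ (r / (1 - β)) :=
    Finset.sum_nonneg fun k _ => hnn k
  generalize ∑ k ∈ Finset.range (n + 1), u k ^ (r / (1 - β)) = S at *
  rcases hS.eq_or_lt with h0 | h0
  · rw [← h0]; positivity
  · have h2 : S ^ (1 - β) ≤ |M| := by
      rw [Real.rpow_sub h0, Real.rpow_one, div_le_iff₀ (by positivity)]
      exact this.trans (mul_le_mul_of_nonneg_right (le_abs_self M) (by positivity))
    calc S = (S ^ (1 - β)) ^ (1 / (1 - β)) := by
          rw [← Real.rpow_mul h0.le, mul_one_div_cancel h1β.ne', Real.rpow_one]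
      _ ≤ _ := Real.rpow_le_rpow (by positivity) h2 (by positivity)

lemma eLpNorm_rpow {E : Type*} [NormedAddCommGroup E] (f : ℝ → E) (r : ℝ) (hr : 0 < r)
    (μ : Measure ℝ) :
    eLpNorm f (ENNReal.ofReal r) μ ^ r = ∫⁻ t, ENNReal.ofReal (‖f t‖ ^ r) ∂μ := by
  rw [eLpNorm_eq_lintegral_rpow_enorm_toReal (by simpa using hr) ENNReal.ofReal_ne_top,
    ENNReal.toReal_ofReal hr.le, ← ENNReal.rpow_mul, one_div_mul_cancel hr.ne', ENNReal.rpow_one]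
  refine lintegral_congr fun t => ?_
  rw [← ofReal_norm, ENNReal.ofReal_rpow_of_nonneg (norm_nonneg _) hr.le]

lemma mono_mem (Λ : ℕ → ℝ) (k : ℕ) :
    (fun x : ℝ => ((x ^ (Λ k) : ℝ) : ℂ)) ∈ MuntzPoly Λ := by
  refine ⟨k, Pi.single k 1, ?_⟩
  funext t
  rw [Finset.sum_eq_single k]
  · simp
  · intro j _ hj; simp [hj]
  · intro h; simp at h

lemma superadd (Λ : ℕ → ℝ) (r : ℝ) (hr : 1 ≤ r) (μ : Measure ℝ)
    (T : (ℝ → ℂ) → ℝ → ℂ) (hT : SublinearOn Λ μ T)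
    (hTpos : ∀ (s : Finset ℕ) (a : ℕ → ℝ), (∀ k, 0 ≤ a k) →
      ∀ᵐ t ∂μ, ∑ k ∈ s, a k * ‖T (fun x : ℝ => ((x ^ (Λ k) : ℝ) : ℂ)) t‖ ≤
        ‖T (fun x : ℝ => ∑ k ∈ s, (a k : ℂ) * ((x ^ (Λ k) : ℝ) : ℂ)) t‖)
    (s : Finset ℕ) (w : ℕ → ℝ) (hw : ∀ k, 0 ≤ w k) :
    ∑ k ∈ s, ENNReal.ofReal (w k ^ r) *
      eLpNorm (T (fun x : ℝ => ((x ^ (Λ k) : ℝ) : ℂ))) (ENNReal.ofReal r) μ ^ r ≤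
    eLpNorm (T (fun x : ℝ => ∑ k ∈ s, (w k : ℂ) * ((x ^ (Λ k) : ℝ) : ℂ)))
      (ENNReal.ofReal r) μ ^ r := by
  have hr0 : 0 < r := by linarith
  simp only [eLpNorm_rpow _ r hr0]
  have hm : ∀ k, AEMeasurable (fun t => ENNReal.ofReal
      (‖T (fun x : ℝ => ((x ^ (Λ k) : ℝ) : ℂ)) t‖ ^ r)) μ := fun k => by
    have := hT.1 _ (mono_mem Λ k)
    exact (this.norm.pow_const r).ennreal_ofReal
  have e : ∀ k ∈ s, ENNReal.ofReal (w k ^ r) * ∫⁻ t, ENNReal.ofReal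
      (‖T (fun x : ℝ => ((x ^ (Λ k) : ℝ) : ℂ)) t‖ ^ r) ∂μ =
      ∫⁻ t, ENNReal.ofReal (w k ^ r) * ENNReal.ofReal
      (‖T (fun x : ℝ => ((x ^ (Λ k) : ℝ) : ℂ)) t‖ ^ r) ∂μ := fun k _ =>
    (lintegral_const_mul'' _ (hm k)).symm
  rw [Finset.sum_congr rfl e, ← lintegral_finsetSum' _ (fun k _ => (hm k).const_mul _)]
  refine lintegral_mono_ae ?_
  filter_upwards [hTpos s w hw] with t ht
  have hx : ∀ k, 0 ≤ w k * ‖T (fun x : ℝ => ((x ^ (Λ k) : ℝ) : ℂ)) t‖ := fun k =>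
    mul_nonneg (hw k) (norm_nonneg _)
  have h1 := sum_rpow_le r hr s _ hx
  have h2 := h1.trans (Real.rpow_le_rpow (Finset.sum_nonneg fun k _ => hx k) ht hr0.le)
  refine le_trans (le_of_eq ?_) (ENNReal.ofReal_le_ofReal h2)
  rw [ENNReal.ofReal_sum_of_nonneg (fun k _ => Real.rpow_nonneg (hx k) _)]
  refine Finset.sum_congr rfl fun k _ => ?_
  rw [Real.mul_rpow (hw k) (norm_nonneg _), ENNReal.ofReal_mul (Real.rpow_nonneg (hw k) _)]

end MuntzAux

/-- necessity of the summability condition for positive operators in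
the lacunary case. -/
theorem muntz_necessity_summability
    (Λ : ℕ → ℝ) (q : ℝ) (hq : 1 < q) (hpos : ∀ k, 0 < Λ k)
    (hlac : ∀ k, q * Λ k ≤ Λ (k + 1)) (hsum : Summable fun k => 1 / Λ k)
    (α β r : ℝ) (hα : 0 < α) (hβ0 : 0 < β) (hβ1 : β < 1) (hr : 1 ≤ r)
    (μ : MeasureTheory.Measure ℝ) (hμ : μ (Set.Icc (0:ℝ) 1)ᶜ = 0)
    (T : (ℝ → ℂ) → ℝ → ℂ) (hT : SublinearOn Λ μ T)
    (hTpos : ∀ (s : Finset ℕ) (a : ℕ → ℝ), (∀ k, 0 ≤ a k) →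
      ∀ᵐ t ∂μ, ∑ k ∈ s, a k * ‖T (fun x : ℝ => ((x ^ (Λ k) : ℝ) : ℂ)) t‖ ≤
        ‖T (fun x : ℝ => ∑ k ∈ s, (a k : ℂ) * ((x ^ (Λ k) : ℝ) : ℂ)) t‖)
    (C : ℝ)
    (hstrong : ∀ f ∈ MuntzPoly Λ,
      MeasureTheory.eLpNorm (T f) (ENNReal.ofReal r) μ ≤
        ENNReal.ofReal C *
          MeasureTheory.eLpNorm f (ENNReal.ofReal (r / β)) (nuMeas α)) :
    Summable fun k : ℕ =>
      ((MeasureTheory.eLpNorm (T fun t : ℝ => ((t ^ (Λ k) : ℝ) : ℂ))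
            (ENNReal.ofReal r) μ).toReal /
        (MeasureTheory.eLpNorm (fun t : ℝ => ((t ^ (Λ k) : ℝ) : ℂ))
            (ENNReal.ofReal (r / β)) (nuMeas α)).toReal) ^ (r / (1 - β)) := by
  have hr0 : 0 < r := by linarith
  have h1β : 0 < 1 - β := by linarith
  set p := r / β with hp
  have hp1 : 1 ≤ p := by rw [hp, le_div_iff₀ hβ0]; linarith
  have hp0 : 0 < p := by linarith
  obtain ⟨D, hD, hup⟩ := MuntzAux.upper Λ q hq hpos hlac α p hα hp1
  obtain ⟨c, hc, hlow⟩ := MuntzAux.lower α p (Λ 0) hα hp0 (hpos 0)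
  have hmono : Monotone Λ := monotone_nat_of_le_succ fun k => by nlinarith [hlac k, hpos k]
  set a := α / p with ha
  -- norm of a nonnegative combination
  have hnorm : ∀ b : ℕ → ℝ, (∀ k, 0 ≤ b k) → ∀ n,
      eLpNorm (fun x : ℝ => ∑ k ∈ Finset.range n, ((b k * Λ k ^ a : ℝ) : ℂ) *
        ((x ^ (Λ k) : ℝ) : ℂ)) (ENNReal.ofReal p) (nuMeas α) ^ p ≤
        ENNReal.ofReal (D * ∑ k ∈ Finset.range n, b k ^ p) := by
    intro b hb n
    rw [MuntzAux.eLpNorm_rpow _ p hp0]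
    refine le_trans (le_of_eq (lintegral_congr fun t => ?_)) (hup b hb n)
    congr 2
    rw [← Real.norm_eq_abs, ← Complex.norm_real]
    congr 1
    push_cast
    rfl
  -- abbreviations
  set E : ℕ → ENNReal := fun k => eLpNorm (fun t : ℝ => ((t ^ (Λ k) : ℝ) : ℂ))
    (ENNReal.ofReal p) (nuMeas α) with hE
  set G : ℕ → ENNReal := fun k => eLpNorm (T fun t : ℝ => ((t ^ (Λ k) : ℝ) : ℂ))
    (ENNReal.ofReal r) μ with hG
  have hEp : ∀ k, E k ^ p = ∫⁻ t, ENNReal.ofReal (|t ^ Λ k| ^ p) ∂(nuMeas α) := by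
    intro k
    rw [hE, MuntzAux.eLpNorm_rpow _ p hp0]
    simp only [Complex.norm_real, Real.norm_eq_abs]
  have hEtop : ∀ k, E k ≠ ⊤ := by
    intro k htop
    have h1 := hup (Pi.single k (Λ k ^ a)⁻¹) (fun j => by
      by_cases h : j = k
      · subst h; simp [Real.rpow_nonneg (hpos j).le]
      · simp [h]) (k + 1)
    have h2 : ∀ t : ℝ, ∑ j ∈ Finset.range (k + 1),
        (Pi.single k (Λ k ^ a)⁻¹ : ℕ → ℝ) j * Λ j ^ a * t ^ Λ j = t ^ Λ k := by
      intro t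
      rw [Finset.sum_eq_single k]
      · have := Real.rpow_pos_of_pos (hpos k) a
        simp only [Pi.single_eq_same]; field_simp
      · intro j _ hj; simp [hj]
      · intro h; simp at h
    simp only [h2, ← hEp, htop, ENNReal.top_rpow_of_pos hp0] at h1
    exact absurd (top_le_iff.mp h1) ENNReal.ofReal_ne_top
  have hGtop : ∀ k, G k ≠ ⊤ := fun k =>
    ne_top_of_le_ne_top (ENNReal.mul_ne_top ENNReal.ofReal_ne_top (hEtop k))
      (hstrong _ (MuntzAux.mono_mem Λ k))
  -- main summability
  have hmain : Summable fun k => (Λ k ^ a * (G k).toReal) ^ (r / (1 - β)) := by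
    refine MuntzAux.dual β r ((max C 0) ^ r * D ^ β) hβ0 hβ1 hr _
      (fun k => mul_nonneg (Real.rpow_nonneg (hpos k).le _) ENNReal.toReal_nonneg) ?_
    intro b hb n
    have hw : ∀ k, 0 ≤ b k * Λ k ^ a := fun k =>
      mul_nonneg (hb k) (Real.rpow_nonneg (hpos k).le _)
    have h1 := MuntzAux.superadd Λ r hr μ T hT hTpos (Finset.range (n + 1))
      (fun k => b k * Λ k ^ a) hw
    have h2 := hstrong (fun x : ℝ => ∑ k ∈ Finset.range (n + 1), ((b k * Λ k ^ a : ℝ) : ℂ) *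
        ((x ^ (Λ k) : ℝ) : ℂ)) ⟨n, fun k => ((b k * Λ k ^ a : ℝ) : ℂ), rfl⟩
    have h3 := h1.trans (ENNReal.rpow_le_rpow h2 hr0.le)
    rw [ENNReal.mul_rpow_of_nonneg _ _ hr0.le] at h3
    have hS : 0 ≤ ∑ k ∈ Finset.range (n + 1), b k ^ p :=
      Finset.sum_nonneg fun k _ => Real.rpow_nonneg (hb k) _
    have h4 := ENNReal.rpow_le_rpow (hnorm b hb (n + 1)) hβ0.le
    rw [← ENNReal.rpow_mul, show p * β = r by rw [hp]; field_simp,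
      ENNReal.ofReal_rpow_of_nonneg (mul_nonneg hD.le hS) hβ0.le,
      Real.mul_rpow hD.le hS] at h4
    have h5 := h3.trans (mul_le_mul_right h4 _)
    have eC : ENNReal.ofReal C = ENNReal.ofReal (max C 0) := by
      rcases le_total C 0 with h | h
      · rw [max_eq_right h, ENNReal.ofReal_of_nonpos h, ENNReal.ofReal_zero]
      · rw [max_eq_left h]
    rw [eC, ENNReal.ofReal_rpow_of_nonneg (le_max_right _ _) hr0.le,
      ← ENNReal.ofReal_mul (by positivity)] at h5
    have e6 : ∀ k, ENNReal.ofReal ((b k * Λ k ^ a) ^ r) * G k ^ r =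
        ENNReal.ofReal ((b k * (Λ k ^ a * (G k).toReal)) ^ r) := by
      intro k
      rw [← mul_assoc, Real.mul_rpow (hw k) ENNReal.toReal_nonneg,
        ENNReal.ofReal_mul (Real.rpow_nonneg (hw k) _),
        ← ENNReal.ofReal_rpow_of_nonneg ENNReal.toReal_nonneg hr0.le,
        ENNReal.ofReal_toReal (hGtop k)]
    have h6 := (le_of_eq (Finset.sum_congr rfl fun k _ => (e6 k).symm)).trans h5
    rw [← ENNReal.ofReal_sum_of_nonneg, ENNReal.ofReal_le_ofReal_iff] at h6
    · rw [mul_assoc]; exact h6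
    · have := Real.rpow_nonneg hS β
      positivity
    · intro k _
      exact Real.rpow_nonneg (mul_nonneg (hb k)
        (mul_nonneg (Real.rpow_nonneg (hpos k).le _) ENNReal.toReal_nonneg)) _
  -- comparison
  have hElow : ∀ k, c ^ (1 / p) * Λ k ^ (-a) ≤ (E k).toReal := by
    intro k
    have h1 := hlow (Λ k) (hmono (Nat.zero_le k))
    rw [← hEp, ← ENNReal.ofReal_toReal (hEtop k),
      ENNReal.ofReal_rpow_of_nonneg ENNReal.toReal_nonneg hp0.le,
      ENNReal.ofReal_le_ofReal_iff (by positivity)] at h1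
    have hl := Real.rpow_pos_of_pos (hpos k) (-α)
    have h2 := Real.rpow_le_rpow (by positivity) h1 (by positivity : 0 ≤ 1 / p)
    rw [← Real.rpow_mul ENNReal.toReal_nonneg, mul_one_div_cancel hp0.ne', Real.rpow_one,
      Real.mul_rpow hc.le hl.le, ← Real.rpow_mul (hpos k).le] at h2
    convert h2 using 3
    rw [ha]; ring
  refine Summable.of_nonneg_of_le (fun k => by positivity) (fun k => ?_)
    (hmain.mul_left ((c ^ (1 / p))⁻¹ ^ (r / (1 - β))))
  have hc' : 0 < c ^ (1 / p) := Real.rpow_pos_of_pos hc _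
  have hl := Real.rpow_pos_of_pos (hpos k) a
  have hG0 : 0 ≤ (G k).toReal := ENNReal.toReal_nonneg
  rw [← Real.mul_rpow (by positivity) (by positivity)]
  refine Real.rpow_le_rpow (by positivity) ?_ (by positivity)
  have h1 := hElow k
  rw [Real.rpow_neg (hpos k).le] at h1
  calc (G k).toReal / (E k).toReal ≤ (G k).toReal / (c ^ (1 / p) * (Λ k ^ a)⁻¹) :=
        div_le_div_of_nonneg_left hG0 (by positivity) h1
    _ = (c ^ (1 / p))⁻¹ * (Λ k ^ a * (G k).toReal) := by field_simp
end
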